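/- arXiv:2010.15286 — 6 statements merged into one kernel-verified Lean document; each statement's English description precedes it below -/
import Mathlib

section
/- Let (A,B,E,E') be an operator-valued infinitesimal probability space, let (A_i)_{i∈I} be a family of subalgebras of A each containing B, and let (Ã,B̃,Ẽ) be the associated upper triangular probability space with Ã_i ⊆ Ã the corresponding upper triangular subalgebras. Then (A_i)_{i∈I} is infinitesimally Boolean independent over B with respect to (E,E') if and only if (Ã_i)_{i∈I} is Boolean independent over B̃ with respect to Ẽ, i.e. for every n ≥ 1, all indices i_1,…,i_n ∈ I with i_1 ≠ i_2, i_2 ≠ i_3, …, i_{n−1} ≠ i_n, and all A_j ∈ Ã_{i_j} (j = 1,…,n), one has Ẽ(A_1⋯A_n) = Ẽ(A_1)⋯Ẽ(A_n). -/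
noncomputable section

open scoped BigOperators

variable {A : Type*} [Ring A] [Algebra ℂ A] {I : Type*}

/-- `E : A → B` is a conditional expectation onto the unital subalgebra `B`. -/
def IsCondExpectation (B : Subalgebra ℂ A) (E : A →ₗ[ℂ] A) : Prop :=
  (∀ a, E a ∈ B) ∧ (∀ b ∈ B, E b = b) ∧
    ∀ a : A, ∀ b ∈ B, ∀ b' ∈ B, E (b * a * b') = b * E a * b'

/-- `E' : A → B` is an infinitesimal conditional expectation: `E'(1) = 0` and the
`B`-bimodule property. -/
def IsInfCondExpectation (B : Subalgebra ℂ A) (E' : A →ₗ[ℂ] A) : Prop :=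
  (∀ a, E' a ∈ B) ∧ E' 1 = 0 ∧
    ∀ a : A, ∀ b ∈ B, ∀ b' ∈ B, E' (b * a * b') = b * E' a * b'

/-- The subalgebras `Asub i` are infinitesimally Boolean independent over `B` with respect
to `(E, E')`: for every `n ≥ 1`, adjacent-distinct indices `i_1 ≠ i_2 ≠ ⋯ ≠ i_n` and
`a_j ∈ A_{i_j}` one has `E(a_1⋯a_n) = E(a_1)⋯E(a_n)` and
`E'(a_1⋯a_n) = Σ_j E(a_1)⋯E'(a_j)⋯E(a_n)`. -/
def InfBooleanIndep (E E' : A →ₗ[ℂ] A) (Asub : I → Subalgebra ℂ A) : Prop :=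
  ∀ n : ℕ, 0 < n → ∀ idx : Fin n → I,
    (∀ (k : Fin n) (h : k.val + 1 < n), idx k ≠ idx ⟨k.val + 1, h⟩) →
    ∀ a : Fin n → A, (∀ k, a k ∈ Asub (idx k)) →
      E (List.ofFn a).prod = (List.ofFn fun k => E (a k)).prod ∧
      E' (List.ofFn a).prod =
        ∑ j : Fin n, (List.ofFn fun k => if k = j then E' (a k) else E (a k)).prod

/-- The map `Ẽ` on the upper triangular algebra `Ã` (realized as the square-zero
extension `DualNumber A` of `A` by itself, i.e. matrices `[[a, a'], [0, a]]`):
`Ẽ([[a,a'],[0,a]]) = [[E a, E a' + E' a], [0, E a]]`. -/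
def tildeE (E E' : A →ₗ[ℂ] A) (X : DualNumber A) : DualNumber A :=
  TrivSqZeroExt.inl (E X.fst) + TrivSqZeroExt.inr (E X.snd + E' X.fst)

/-- The product of a finite family is additive in each slot. -/
theorem List.prod_ofFn_ite_add {R : Type*} [Ring R] {n : ℕ} (u v w : Fin n → R) (j : Fin n) :
    (List.ofFn fun k => if k = j then u k + v k else w k).prod =
      (List.ofFn fun k => if k = j then u k else w k).prod +
        (List.ofFn fun k => if k = j then v k else w k).prod := by
  have key (f : Fin n → R) : (fun k => if k = j then f k else w k) = Function.update w j (f j) := by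
    ext k
    by_cases h : k = j
    · subst h; simp
    · simp [h]
  have h := (MultilinearMap.mkPiAlgebraFin ℤ n R).map_update_add w j (u j) (v j)
  simp only [MultilinearMap.mkPiAlgebraFin_apply] at h
  rw [key u, key v, key fun k => u k + v k, h]

/-- The first component of a product of dual numbers is the product of first components. -/
theorem DualNumber.fst_prod_ofFn {R : Type*} [Ring R] {n : ℕ} (X : Fin n → DualNumber R) :
    (List.ofFn X).prod.fst = (List.ofFn fun k => (X k).fst).prod := by
  rw [TrivSqZeroExt.fst_list_prod, List.map_ofFn]
  rfl

/-- The Leibniz rule for the second component of a product of dual numbers. -/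
theorem DualNumber.snd_prod_ofFn {R : Type*} [Ring R] {n : ℕ} (X : Fin n → DualNumber R) :
    (List.ofFn X).prod.snd =
      ∑ j : Fin n, (List.ofFn fun k => if k = j then (X k).snd else (X k).fst).prod := by
  induction n with
  | zero => simp
  | succ n ih =>
    rw [List.ofFn_succ, List.prod_cons, TrivSqZeroExt.snd_mul, ih, fst_prod_ofFn,
      Fin.sum_univ_succ]
    simp [List.ofFn_succ, Finset.mul_sum, add_comm, Fin.succ_ne_zero, (Fin.succ_ne_zero _).symm]

@[simp]
theorem fst_tildeE (E E' : A →ₗ[ℂ] A) (X : DualNumber A) : (tildeE E E' X).fst = E X.fst := by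
  simp [tildeE]

@[simp]
theorem snd_tildeE (E E' : A →ₗ[ℂ] A) (X : DualNumber A) :
    (tildeE E E' X).snd = E X.snd + E' X.fst := by
  simp [tildeE]

/-- Proposition: `(A_i)` are infinitesimally Boolean independent over `B` with respect to
`(E, E')` iff the upper triangular subalgebras `(Ã_i)` are Boolean independent over `B̃`
with respect to `Ẽ`. -/
theorem infBoolean_iff_boolean_upper_triangular
    (B : Subalgebra ℂ A) (E E' : A →ₗ[ℂ] A)
    (hE : IsCondExpectation B E) (hE' : IsInfCondExpectation B E')
    (Asub : I → Subalgebra ℂ A) (hB : ∀ i, B ≤ Asub i) :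
    InfBooleanIndep E E' Asub ↔
      ∀ n : ℕ, 0 < n → ∀ idx : Fin n → I,
        (∀ (k : Fin n) (h : k.val + 1 < n), idx k ≠ idx ⟨k.val + 1, h⟩) →
        ∀ X : Fin n → DualNumber A,
          (∀ k, (X k).fst ∈ Asub (idx k) ∧ (X k).snd ∈ Asub (idx k)) →
          tildeE E E' (List.ofFn X).prod = (List.ofFn fun k => tildeE E E' (X k)).prod := by
  constructor
  · intro h n hn idx hidx X hX
    obtain ⟨hE_prod, hE'_prod⟩ := h n hn idx hidx (fun k => (X k).fst) fun k => (hX k).1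
    ext
    · simp only [fst_tildeE, DualNumber.fst_prod_ofFn, hE_prod]
    · simp only [snd_tildeE, fst_tildeE, DualNumber.fst_prod_ofFn, DualNumber.snd_prod_ofFn,
        hE'_prod, map_sum, List.prod_ofFn_ite_add, Finset.sum_add_distrib]
      congr 1
      refine Finset.sum_congr rfl fun j _ => ?_
      rw [(h n hn idx hidx (fun k => if k = j then (X k).snd else (X k).fst) fun k => ?_).1]
      · simp only [apply_ite E]
      · split_ifs
        exacts [(hX k).2, (hX k).1]
  · intro h n hn idx hidx a ha
    have hX := h n hn idx hidx (fun k => TrivSqZeroExt.inl (a k)) fun k => by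
      simpa using ha k
    constructor
    · simpa [DualNumber.fst_prod_ofFn] using congrArg TrivSqZeroExt.fst hX
    · have hsnd : (List.ofFn fun k => (TrivSqZeroExt.inl (a k) : DualNumber A)).prod.snd = 0 := by
        rw [DualNumber.snd_prod_ofFn]
        refine Finset.sum_eq_zero fun j _ => List.prod_eq_zero ?_
        exact List.mem_ofFn.2 ⟨j, by simp⟩
      have := congrArg TrivSqZeroExt.snd hX
      rw [snd_tildeE, hsnd] at this
      simpa [DualNumber.fst_prod_ofFn, DualNumber.snd_prod_ofFn] using this
end
end

section
/- Let (A,B,E,E') be a C*-operator-valued infinitesimal probability space and let x,y ∈ A be self-adjoint elements which are infinitesimally Boolean independent over B. Then for every b ∈ H⁺(B): G_x(b), G_y(b) and F_x(b) + F_y(b) − b are invertible, and g_{x+y}(b) = (F_x(b) + F_y(b) − b)⁻¹ ( F_x(b) g_x(b) F_x(b) + F_y(b) g_y(b) F_y(b) ) (F_x(b) + F_y(b) − b)⁻¹. -/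
noncomputable section

open scoped BigOperators
open Matrix

variable {A : Type*} [NormedRing A] [StarRing A] [CStarRing A] [CompleteSpace A]
  [NormedAlgebra ℂ A] [StarModule ℂ A]

/-- The imaginary part `Im(a) = (a - a*) / (2i)` of an element of a C*-algebra. -/
def imagPart (a : A) : A := ((2 * Complex.I)⁻¹ : ℂ) • (a - star a)

/-- An element is positive and invertible. -/
def IsPositiveInvertible (a : A) : Prop := (∃ y : A, a = star y * y) ∧ IsUnit a

/-- The operator upper half-plane `H⁺(B) = {b ∈ B : Im(b) positive and invertible}`. -/
def Hplus (B : Subalgebra ℂ A) : Set A := {b | b ∈ B ∧ IsPositiveInvertible (imagPart b)}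

/-- `E` is completely positive: every positive matrix over `A` is mapped entrywise to a
positive matrix. -/
def CompletelyPositive (E : A →ₗ[ℂ] A) : Prop :=
  ∀ (n : ℕ) (M : Matrix (Fin n) (Fin n) A),
    (∃ N : Matrix (Fin n) (Fin n) A, M = Nᴴ * N) →
    ∃ P : Matrix (Fin n) (Fin n) A, M.map ⇑E = Pᴴ * P

/-- The set of products `b₀ x b₁ x ⋯ x b_m` with `m ≥ 1` and `b_i ∈ B`. -/
def genSet (B : Set A) (x : A) : Set A :=
  {a | ∃ m : ℕ, 0 < m ∧ ∃ b : Fin (m + 1) → A, (∀ i, b i ∈ B) ∧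
    a = (List.ofFn fun i : Fin m => b i.castSucc * x).prod * b (Fin.last m)}

/-- The (non-unital) `B`-bimodule subalgebra of `A` generated by `x`: the linear span of
the products `b₀ x b₁ x ⋯ x b_m`, `m ≥ 1`, `b_i ∈ B`. -/
def genAlg (B : Set A) (x : A) : Submodule ℂ A := Submodule.span ℂ (genSet B x)

/-- Two subalgebras `Ax`, `Ay` are infinitesimally Boolean independent with respect to
`(E, E')`: for every alternating tuple `a_1, …, a_n` (consecutive entries belonging
alternately to `Ax` and `Ay`), `E(a_1⋯a_n) = E(a_1)⋯E(a_n)` and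
`E'(a_1⋯a_n) = Σ_j E(a_1)⋯E'(a_j)⋯E(a_n)`. -/
def InfBooleanPair (E E' : A → A) (Ax Ay : Submodule ℂ A) : Prop :=
  ∀ n : ℕ, 0 < n → ∀ f : Fin n → Bool,
    (∀ (k : Fin n) (h : k.val + 1 < n), f k ≠ f ⟨k.val + 1, h⟩) →
    ∀ a : Fin n → A, (∀ k, a k ∈ if f k then Ax else Ay) →
      E (List.ofFn a).prod = (List.ofFn fun k => E (a k)).prod ∧
      E' (List.ofFn a).prod =
        ∑ j : Fin n, (List.ofFn fun k => if k = j then E' (a k) else E (a k)).prod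

section

variable {C : Type*} [CStarAlgebra C] [PartialOrder C] [StarOrderedRing C]

/-- An element with strictly positive imaginary part is invertible. -/
theorem isUnit_of_isStrictlyPositive_imagPart {a : C} (ha : IsStrictlyPositive (imagPart a)) :
    IsUnit a := by
  set s := CFC.sqrt (imagPart a) with hs
  have hs_sa : star s = s := (CFC.sqrt_nonneg (imagPart a)).isSelfAdjoint
  have hss : s * s = imagPart a := CFC.sqrt_mul_sqrt_self _ ha.nonneg
  obtain ⟨u, hu⟩ : IsUnit s := ha.isUnit_cfcSqrt
  have hu_sa : star (↑u⁻¹ : C) = ↑u⁻¹ := by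
    have : star u = u := Units.ext (by simp [hu, hs_sa])
    rw [← Units.coe_star_inv, this]
  set r : C := (2⁻¹ : ℂ) • (a + star a) with hr
  have hr_sa : star r = r := by
    simp [hr, add_comm]
  have ha_eq : a = r + Complex.I • imagPart a := by
    have : Complex.I * (2 * Complex.I)⁻¹ = 2⁻¹ := by
      field_simp
    rw [imagPart, smul_smul, this, hr, ← smul_add]
    rw [add_add_sub_cancel, ← two_smul ℂ a, smul_smul]
    norm_num
  set t : C := ↑u⁻¹ * r * ↑u⁻¹ with ht
  have ht_sa : IsSelfAdjoint t := by
    rw [isSelfAdjoint_iff]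
    simp only [ht, star_mul, hu_sa, hr_sa, mul_assoc]
  have h1 : IsUnit (t + Complex.I • 1) := by
    have : -Complex.I ∉ spectrum ℂ t := fun h => by
      have := ht_sa.im_eq_zero_of_mem_spectrum h
      simp at this
    rw [spectrum.notMem_iff] at this
    have h2 := this.neg
    rwa [Algebra.algebraMap_eq_smul_one, neg_smul, neg_sub, sub_neg_eq_add] at h2
  have h3 : a = u * (t + Complex.I • 1) * u := by
    rw [mul_add, add_mul]
    simp only [mul_smul_comm, smul_mul_assoc, mul_one]
    rw [hu, hss, ← hu]
    conv_lhs => rw [ha_eq]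
    simp [ht, mul_assoc]
  rw [h3]
  exact (u.isUnit.mul h1).mul u.isUnit

theorem map_isStrictlyPositive_of_map_one {f : C →ₚ[ℂ] C} (hf : f 1 = 1) {a : C}
    (ha : IsStrictlyPositive a) : IsStrictlyPositive (f a) := by
  nontriviality C
  obtain ⟨r, hr, hra⟩ := (CFC.exists_pos_algebraMap_le_iff (a := a) ha.isSelfAdjoint).2
    fun x hx => ha.spectrum_pos hx
  have h1 : f (algebraMap ℝ C r) = algebraMap ℝ C r := by
    rw [Algebra.algebraMap_eq_smul_one, ← Complex.coe_smul, map_smul, hf]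
  have h2 : IsStrictlyPositive (algebraMap ℝ C r) := by
    refine ⟨?_, (IsUnit.mk0 r hr.ne').map (algebraMap ℝ C)⟩
    rw [Algebra.algebraMap_eq_smul_one]
    exact smul_nonneg hr.le zero_le_one
  exact h2.of_le (h1 ▸ OrderHomClass.mono f hra)

theorem isUnit_map_inverse {f : C →ₚ[ℂ] C} (hf : f 1 = 1) {a : C}
    (ha : IsStrictlyPositive (imagPart a)) : IsUnit (f (Ring.inverse a)) := by
  obtain ⟨u, rfl⟩ := isUnit_of_isStrictlyPositive_imagPart ha
  rw [Ring.inverse_unit, ← IsUnit.neg_iff]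
  have h : imagPart (-(↑u⁻¹ : C)) = star (↑u⁻¹ : C) * imagPart (u : C) * ↑u⁻¹ := by
    simp only [imagPart, mul_smul_comm, smul_mul_assoc, mul_sub, sub_mul, star_neg]
    have : star (↑u⁻¹ : C) * star (u : C) = 1 := by rw [← star_mul]; simp
    rw [this]
    rw [mul_assoc (star (↑u⁻¹ : C)), u.mul_inv, mul_one, one_mul]
    congr 1
    abel
  apply isUnit_of_isStrictlyPositive_imagPart
  have h2 : imagPart (-f ↑u⁻¹) = f (imagPart (-(↑u⁻¹ : C))) := by
    simp only [imagPart, map_smul, map_sub, map_neg, star_neg, map_star]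
  rw [h2, h]
  refine map_isStrictlyPositive_of_map_one hf ⟨star_left_conjugate_nonneg ha.nonneg _, ?_⟩
  exact (u⁻¹.isUnit.star.mul ha.isUnit).mul u⁻¹.isUnit

end

section

variable {C : Type*} [CStarAlgebra C]

theorem inverse_mem_closure_adjoin {s : Set C} (hs : ∀ a ∈ s, star a ∈ s) {a : C}
    (ha : a ∈ Algebra.adjoin ℂ s) : Ring.inverse a ∈ closure (Algebra.adjoin ℂ s : Set C) := by
  by_cases hu : IsUnit a
  swap
  · rw [Ring.inverse_non_unit _ hu]
    exact subset_closure (zero_mem _)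
  have hS : (StarAlgebra.adjoin ℂ s : Set C) = Algebra.adjoin ℂ s := by
    have : star s ⊆ s := fun a ha => star_star a ▸ hs _ ha
    change ((StarAlgebra.adjoin ℂ s).toSubalgebra : Set C) = _
    rw [StarAlgebra.adjoin_toSubalgebra, Set.union_eq_self_of_subset_right this]
  set T := (StarAlgebra.adjoin ℂ s).topologicalClosure with hT
  have : IsClosed (T : Set C) := StarSubalgebra.isClosed_topologicalClosure _
  have haT : a ∈ T := StarSubalgebra.le_topologicalClosure _ (by
    rw [← SetLike.mem_coe, hS]; exact ha)
  obtain ⟨u, hu'⟩ := (T.coe_isUnit (a := ⟨a, haT⟩)).1 hu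
  have h2 : Ring.inverse a = ((↑u⁻¹ : T) : C) := by
    have h3 : a * ((↑u⁻¹ : T) : C) = 1 := by
      have := congrArg (Subtype.val) (u.mul_inv)
      rw [hu'] at this
      simpa using this
    calc Ring.inverse a = Ring.inverse a * (a * ((↑u⁻¹ : T) : C)) := by rw [h3, mul_one]
      _ = _ := by rw [← mul_assoc, Ring.inverse_mul_cancel _ hu, one_mul]
  rw [h2, ← hS, ← StarSubalgebra.topologicalClosure_coe]
  exact (↑u⁻¹ : T).2

end

section

variable {R : Type*} [NormedRing R] [NormedAlgebra ℂ R] {B : Subalgebra ℂ R} {x : R}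

theorem mul_mem_genAlg_of_mem {b : R} (hb : b ∈ B) {a : R} (ha : a ∈ genAlg (B : Set R) x) :
    b * a ∈ genAlg (B : Set R) x := by
  suffices genAlg (B : Set R) x ≤ (genAlg (B : Set R) x).comap (LinearMap.mulLeft ℂ b) from this ha
  refine Submodule.span_le.2 ?_
  rintro _ ⟨m, hm, c, hc, rfl⟩
  obtain ⟨m, rfl⟩ := Nat.exists_eq_succ_of_ne_zero hm.ne'
  refine Submodule.subset_span ⟨m + 1, hm, Fin.cons (b * c 0) (Fin.tail c), ?_, ?_⟩
  · refine Fin.cases ?_ fun i => ?_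
    · exact B.mul_mem hb (hc 0)
    · exact hc _
  · simp [List.ofFn_succ, mul_assoc, Fin.tail, ← Fin.succ_last]

theorem self_mul_mem_genAlg {a : R} (ha : a ∈ genAlg (B : Set R) x) :
    x * a ∈ genAlg (B : Set R) x := by
  suffices genAlg (B : Set R) x ≤ (genAlg (B : Set R) x).comap (LinearMap.mulLeft ℂ x) from this ha
  refine Submodule.span_le.2 ?_
  rintro _ ⟨m, hm, c, hc, rfl⟩
  refine Submodule.subset_span ⟨m + 1, m.succ_pos, Fin.cons 1 c, ?_, ?_⟩
  · refine Fin.cases ?_ fun i => ?_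
    · exact B.one_mem
    · exact hc _
  · simp [List.ofFn_succ, mul_assoc, ← Fin.succ_last]

theorem self_mul_mem_genAlg_of_mem {b : R} (hb : b ∈ B) : x * b ∈ genAlg (B : Set R) x := by
  refine Submodule.subset_span ⟨1, one_pos, ![1, b], ?_, ?_⟩
  · refine Fin.cases B.one_mem fun i => ?_
    simpa [Fin.eq_zero i] using hb
  · simp [List.ofFn_succ]

/-- Products of alternating words whose first letter lies in `P c`. -/
def AltWord (P : Bool → Submodule ℂ R) (c : Bool) (w : R) : Prop :=
  ∃ (n : ℕ) (f : Fin (n + 1) → Bool) (a : Fin (n + 1) → R), f 0 = c ∧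
    (∀ (k : Fin (n + 1)) (h : k.val + 1 < n + 1), f k ≠ f ⟨k.val + 1, h⟩) ∧
    (∀ k, a k ∈ P (f k)) ∧ w = (List.ofFn a).prod

variable {P : Bool → Submodule ℂ R} {c : Bool} {a w : R}

theorem AltWord.of_mem (ha : a ∈ P c) : AltWord P c a :=
  ⟨0, fun _ => c, fun _ => a, rfl, fun k h => by omega, fun _ => ha, by simp⟩

theorem AltWord.cons (ha : a ∈ P c) (hw : AltWord P (!c) w) : AltWord P c (a * w) := by
  obtain ⟨n, f, v, hf, halt, hv, rfl⟩ := hw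
  refine ⟨n + 1, Fin.cons c f, Fin.cons a v, rfl, ?_, ?_, by simp [List.ofFn_succ]⟩
  · refine Fin.cases ?_ fun k => ?_
    · intro h
      change c ≠ f 0
      simp [hf]
    · intro h
      exact halt k (by simpa using h)
  · exact Fin.cases ha hv

theorem AltWord.mul_left {g : R} (hg : ∀ a ∈ P c, g * a ∈ P c) (hw : AltWord P c w) :
    AltWord P c (g * w) := by
  obtain ⟨n, f, v, hf, halt, hv, rfl⟩ := hw
  refine ⟨n, f, Fin.cons (g * v 0) (Fin.tail v), hf, halt, ?_, ?_⟩
  · refine Fin.cases ?_ fun k => hv _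
    rw [hf]
    exact hg _ (hf ▸ hv 0)
  · simp [List.ofFn_succ, mul_assoc, Fin.tail]

theorem InfBooleanPair.map_mul_of_altWord {E E' : R → R}
    (h : InfBooleanPair E E' (P true) (P false)) (ha : a ∈ P c) (hw : AltWord P (!c) w) :
    E (a * w) = E a * E w ∧ E' (a * w) = E' a * E w + E a * E' w := by
  have hP : ∀ d, (if d = true then P true else P false) = P d := by rintro (_ | _) <;> simp
  obtain ⟨n, f, v, hf, halt, hv, rfl⟩ := hw
  have h1 := h (n + 1) n.succ_pos f halt v fun k => by rw [hP]; exact hv k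
  have h2 := h (n + 2) (by omega) (Fin.cons c f) (by
    refine Fin.cases ?_ fun k => ?_
    · intro h
      change c ≠ f 0
      simp [hf]
    · intro h
      exact halt k (by simpa using h)) (Fin.cons a v) (by
    intro k
    rw [hP]
    exact Fin.cases (motive := fun k => (Fin.cons a v : Fin (n + 2) → R) k ∈
      P ((Fin.cons c f : Fin (n + 2) → Bool) k)) ha hv k)
  rw [List.ofFn_succ, List.prod_cons] at h2
  simp only [Fin.cons_zero, Fin.cons_succ] at h2
  rw [h2.1, h2.2, h1.1, h1.2, Fin.sum_univ_succ, Finset.mul_sum]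
  refine ⟨by rw [List.ofFn_succ, List.prod_cons]; simp, ?_⟩
  congr 1
  · rw [List.ofFn_succ, List.prod_cons]
    simp [Fin.succ_ne_zero]
  · refine Finset.sum_congr rfl fun j _ => ?_
    rw [List.ofFn_succ, List.prod_cons]
    simp [(Fin.succ_ne_zero j).symm]

/-- A subspace containing `1` and stable under left multiplication by `s` contains the algebra
generated by `s`. -/
theorem adjoin_le_of_mul_mem {s : Set R} {V : Submodule ℂ R} (h1 : 1 ∈ V)
    (hV : ∀ g ∈ s, ∀ v ∈ V, g * v ∈ V) {d : R} (hd : d ∈ Algebra.adjoin ℂ s) : d ∈ V := by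
  suffices ∀ v ∈ V, d * v ∈ V by simpa using this 1 h1
  induction hd using Algebra.adjoin_induction with
  | mem g hg => exact hV g hg
  | algebraMap r =>
    intro v hv
    rw [← Algebra.smul_def]
    exact V.smul_mem r hv
  | add p q _ _ hp hq =>
    intro v hv
    rw [add_mul]
    exact V.add_mem (hp v hv) (hq v hv)
  | mul p q _ _ hp hq =>
    intro v hv
    rw [mul_assoc]
    exact hp _ (hq v hv)

theorem mem_sup_genAlg_of_mem_adjoin {d : R} (hd : d ∈ Algebra.adjoin ℂ (insert x (B : Set R))) :
    d ∈ Subalgebra.toSubmodule B ⊔ genAlg (B : Set R) x := by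
  refine adjoin_le_of_mul_mem (le_sup_left (a := Subalgebra.toSubmodule B) B.one_mem) ?_ hd
  intro g hg
  suffices Subalgebra.toSubmodule B ⊔ genAlg (B : Set R) x ≤
      (Subalgebra.toSubmodule B ⊔ genAlg (B : Set R) x).comap (LinearMap.mulLeft ℂ g) from
    fun v hv => this hv
  rcases hg with rfl | hg
  · exact sup_le (fun v hv => le_sup_right (a := Subalgebra.toSubmodule B)
      (self_mul_mem_genAlg_of_mem hv)) fun v hv => le_sup_right (a := Subalgebra.toSubmodule B)
      (self_mul_mem_genAlg hv)
  · exact sup_le (fun v hv => le_sup_left (a := Subalgebra.toSubmodule B) (B.mul_mem hg hv))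
      fun v hv => le_sup_right (a := Subalgebra.toSubmodule B) (mul_mem_genAlg_of_mem hg hv)

variable {z : Bool → R}

theorem mul_mem_span_altWord_of_mem_adjoin (hP : ∀ c, P c = genAlg (B : Set R) (z c)) (c : Bool)
    {d : R} (hd : d ∈ Algebra.adjoin ℂ (Set.range z ∪ B)) :
    z c * d ∈ Submodule.span ℂ {w | AltWord P c w} := by
  set S : Bool → Submodule ℂ R := fun c => Submodule.span ℂ {w | AltWord P c w} with hS
  set V : Submodule ℂ R := Subalgebra.toSubmodule B ⊔ ⨆ c, S c with hVdef
  have hBV : Subalgebra.toSubmodule B ≤ V := le_sup_left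
  have hSV : ∀ c, S c ≤ V := fun c => (le_iSup S c).trans le_sup_right
  have hz : ∀ c, V ≤ (S c).comap (LinearMap.mulLeft ℂ (z c)) := by
    intro c
    refine sup_le (fun v hv => Submodule.subset_span (AltWord.of_mem ?_))
      (iSup_le fun c' => Submodule.span_le.2 fun w hw => Submodule.subset_span ?_)
    · rw [hP]
      exact self_mul_mem_genAlg_of_mem hv
    · obtain rfl | rfl : c' = c ∨ c' = !c := by cases c <;> cases c' <;> simp
      · refine AltWord.mul_left (fun a ha => ?_) hw
        rw [hP] at ha ⊢
        exact self_mul_mem_genAlg ha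
      · refine AltWord.cons ?_ hw
        rw [hP]
        simpa using self_mul_mem_genAlg_of_mem (x := z c) B.one_mem
  have hb : ∀ b ∈ B, V ≤ V.comap (LinearMap.mulLeft ℂ b) := by
    intro b hb
    refine sup_le (fun v hv => hBV (B.mul_mem hb hv))
      (iSup_le fun c' => Submodule.span_le.2 fun w hw => hSV c' (Submodule.subset_span ?_))
    refine AltWord.mul_left (fun a ha => ?_) hw
    rw [hP] at ha ⊢
    exact mul_mem_genAlg_of_mem hb ha
  refine hz c (adjoin_le_of_mul_mem (hBV B.one_mem) ?_ hd)
  rintro g (⟨c', rfl⟩ | hg) v hv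
  · exact hSV c' (hz c' hv)
  · exact hb g hg hv

theorem InfBooleanPair.map_mul_of_mem_closure {E E' : R →L[ℂ] R}
    (hEproj : ∀ b ∈ B, E b = b)
    (hEbimod : ∀ a : R, ∀ b ∈ B, ∀ b' ∈ B, E (b * a * b') = b * E a * b')
    (hE'one : E' 1 = 0)
    (hE'bimod : ∀ a : R, ∀ b ∈ B, ∀ b' ∈ B, E' (b * a * b') = b * E' a * b')
    (hP : ∀ c, P c = genAlg (B : Set R) (z c))
    (h : InfBooleanPair E E' (P true) (P false)) (c : Bool) {X T : R}
    (hX : X ∈ closure (Algebra.adjoin ℂ (insert (z c) (B : Set R)) : Set R))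
    (hT : T ∈ closure (Algebra.adjoin ℂ (Set.range z ∪ B) : Set R)) :
    E (X * (z (!c) * T)) = E X * E (z (!c) * T) ∧
      E' (X * (z (!c) * T)) = E' X * E (z (!c) * T) + E X * E' (z (!c) * T) := by
  have hE'zero : ∀ b ∈ B, E' b = 0 := fun b hb => by
    simpa [hE'one] using hE'bimod 1 b hb 1 B.one_mem
  have hword : ∀ a ∈ P c, ∀ w ∈ Submodule.span ℂ {w | AltWord P (!c) w},
      E (a * w) = E a * E w ∧ E' (a * w) = E' a * E w + E a * E' w := by
    intro a ha w hw
    induction hw using Submodule.span_induction with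
    | mem w hw => exact h.map_mul_of_altWord ha hw
    | zero => simp
    | add p q _ _ hp hq =>
      simp only [mul_add, map_add, hp.1, hp.2, hq.1, hq.2, true_and]
      abel
    | smul r p _ hp => simp [hp.1, hp.2]
  have hclosed : IsClosed {p : R × R | E (p.1 * (z (!c) * p.2)) = E p.1 * E (z (!c) * p.2) ∧
      E' (p.1 * (z (!c) * p.2)) = E' p.1 * E (z (!c) * p.2) + E p.1 * E' (z (!c) * p.2)} :=
    (isClosed_eq (by fun_prop) (by fun_prop)).inter (isClosed_eq (by fun_prop) (by fun_prop))
  have hXT : (X, T) ∈ closure ((Algebra.adjoin ℂ (insert (z c) (B : Set R)) : Set R) ×ˢ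
      (Algebra.adjoin ℂ (Set.range z ∪ B) : Set R)) := by
    rw [closure_prod_eq]
    exact ⟨hX, hT⟩
  refine closure_minimal ?_ hclosed hXT
  rintro ⟨p, d⟩ ⟨hp, hd⟩
  obtain ⟨b, hb, a, ha, rfl⟩ := Submodule.mem_sup.1 (mem_sup_genAlg_of_mem_adjoin hp)
  have h1 := hword a (hP c ▸ ha) _ (mul_mem_span_altWord_of_mem_adjoin hP (!c) hd)
  have h2 := hEbimod (z (!c) * d) b hb 1 B.one_mem
  have h3 := hE'bimod (z (!c) * d) b hb 1 B.one_mem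
  rw [mul_one, mul_one] at h2 h3
  simp only [Set.mem_ofPred_eq, add_mul, map_add, h1.1, h1.2, h2, h3, hEproj b hb, hE'zero b hb,
    true_and]
  noncomm_ring

end

/-- Theorem (OVI Boolean additive convolution): if `x`, `y` are self-adjoint and
infinitesimally Boolean independent over `B` in a C*-operator-valued infinitesimal
probability space `(A, B, E, E')`, then for every `b ∈ H⁺(B)`, `G_x(b)`, `G_y(b)` and
`F_x(b) + F_y(b) - b` are invertible and
`g_{x+y}(b) = (F_x(b)+F_y(b)-b)⁻¹ (F_x(b) g_x(b) F_x(b) + F_y(b) g_y(b) F_y(b)) (F_x(b)+F_y(b)-b)⁻¹`,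
where `G_x(b) = E((b-x)⁻¹)`, `g_x(b) = E'((b-x)⁻¹)` and `F_x(b) = G_x(b)⁻¹`. -/
theorem ovi_boolean_convolution
    (B : Subalgebra ℂ A) (hBclosed : IsClosed (B : Set A))
    (hBstar : ∀ b ∈ B, star b ∈ B)
    (E : A →ₗ[ℂ] A) (E' : A →L[ℂ] A)
    (hErange : ∀ a, E a ∈ B) (hEproj : ∀ b ∈ B, E b = b)
    (hEbimod : ∀ a : A, ∀ b ∈ B, ∀ b' ∈ B, E (b * a * b') = b * E a * b')
    (hEcp : CompletelyPositive E)
    (hE'range : ∀ a, E' a ∈ B) (hE'one : E' 1 = 0)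
    (hE'star : ∀ a, E' (star a) = star (E' a))
    (hE'bimod : ∀ a : A, ∀ b ∈ B, ∀ b' ∈ B, E' (b * a * b') = b * E' a * b')
    (x y : A) (hx : IsSelfAdjoint x) (hy : IsSelfAdjoint y)
    (hindep : InfBooleanPair ⇑E ⇑E' (genAlg (B : Set A) x) (genAlg (B : Set A) y))
    (b : A) (hb : b ∈ Hplus B)
    (Fx Fy : A)
    (hFx : Fx = Ring.inverse (E (Ring.inverse (b - x))))
    (hFy : Fy = Ring.inverse (E (Ring.inverse (b - y)))) :
    IsUnit (E (Ring.inverse (b - x))) ∧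
    IsUnit (E (Ring.inverse (b - y))) ∧
    IsUnit (Fx + Fy - b) ∧
    E' (Ring.inverse (b - (x + y))) =
      Ring.inverse (Fx + Fy - b) *
        (Fx * E' (Ring.inverse (b - x)) * Fx + Fy * E' (Ring.inverse (b - y)) * Fy) *
        Ring.inverse (Fx + Fy - b) := by
  let _ : CStarAlgebra A := {}
  let _ : PartialOrder A := CStarAlgebra.spectralOrder A
  have : StarOrderedRing A := CStarAlgebra.spectralOrderedRing A
  have hEone : E 1 = 1 := hEproj 1 B.one_mem
  have hEpos : ∀ a : A, 0 ≤ a → 0 ≤ E a := by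
    intro a ha
    obtain ⟨v, rfl⟩ := CStarAlgebra.nonneg_iff_eq_star_mul_self.1 ha
    obtain ⟨M, hM⟩ := hEcp 1 (Matrix.of fun _ _ => star v * v) ⟨Matrix.of fun _ _ => v, by
      ext i j
      simp [Matrix.mul_apply]⟩
    have h00 := congrFun (congrFun hM 0) 0
    simp only [Matrix.map_apply, Matrix.of_apply, Matrix.mul_apply, Fin.sum_univ_one,
      Matrix.conjTranspose_apply] at h00
    exact h00 ▸ star_mul_self_nonneg _
  obtain ⟨f, hf⟩ : ∃ f : A →ₚ[ℂ] A, ∀ a, f a = E a :=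
    ⟨PositiveLinearMap.mk₀ E hEpos, fun _ => rfl⟩
  obtain ⟨Ec, hEc⟩ : ∃ Ec : A →L[ℂ] A, ⇑Ec = ⇑E :=
    ⟨⟨E, show Continuous ⇑E from (funext hf : ⇑f = ⇑E) ▸ map_continuous f⟩, rfl⟩
  have him : ∀ t : A, IsSelfAdjoint t → IsStrictlyPositive (imagPart (b - t)) := by
    intro t ht
    have : imagPart (b - t) = imagPart b := by
      simp [imagPart, ht.star_eq]
    obtain ⟨⟨v, hv⟩, hu⟩ := hb.2
    rw [this]
    exact hu.isStrictlyPositive (hv ▸ star_mul_self_nonneg v)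
  have hunit : ∀ t : A, IsSelfAdjoint t → IsUnit (E (Ring.inverse (b - t))) := fun t ht =>
    hf _ ▸ isUnit_map_inverse ((hf 1).trans hEone) (him t ht)
  have hbm : ∀ T, E (b * T) = b * E T := fun T => by
    simpa using hEbimod T b hb.1 1 B.one_mem
  have hb'm : ∀ T, E' (b * T) = b * E' T := fun T => by
    simpa using hE'bimod T b hb.1 1 B.one_mem
  set z : Bool → A := fun c => if c then x else y with hz
  have hzsa : ∀ c, IsSelfAdjoint (z c) := by
    rintro (_ | _)
    exacts [hy, hx]
  set T := Ring.inverse (b - (x + y)) with hTdef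
  have hTmul : (b - (x + y)) * T = 1 :=
    Ring.mul_inverse_cancel _ (isUnit_of_isStrictlyPositive_imagPart (him _ (hx.add hy)))
  have hT : T ∈ closure (Algebra.adjoin ℂ (Set.range z ∪ B) : Set A) := by
    refine inverse_mem_closure_adjoin ?_ (sub_mem (Algebra.subset_adjoin (Or.inr hb.1))
      (add_mem (Algebra.subset_adjoin (Or.inl ⟨true, rfl⟩))
        (Algebra.subset_adjoin (Or.inl ⟨false, rfl⟩))))
    rintro _ (⟨c, rfl⟩ | ha)
    · exact Or.inl ⟨c, (hzsa c).star_eq.symm⟩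
    · exact Or.inr (hBstar _ ha)
  have key : ∀ c, E T = E (Ring.inverse (b - z c)) * (1 + E (z (!c) * T)) ∧
      E' T = E' (Ring.inverse (b - z c)) * (1 + E (z (!c) * T)) +
        E (Ring.inverse (b - z c)) * E' (z (!c) * T) := by
    intro c
    have hX : Ring.inverse (b - z c) ∈
        closure (Algebra.adjoin ℂ (insert (z c) (B : Set A)) : Set A) := by
      refine inverse_mem_closure_adjoin ?_ (sub_mem (Algebra.subset_adjoin (Or.inr hb.1))
        (Algebra.subset_adjoin (Or.inl rfl)))
      rintro _ (rfl | ha)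
      · exact Or.inl (hzsa c)
      · exact Or.inr (hBstar _ ha)
    have hfac := InfBooleanPair.map_mul_of_mem_closure (E := Ec) (E' := E') (B := B)
      (P := fun c => genAlg (B : Set A) (z c)) (z := z) (by rwa [hEc]) (by rwa [hEc]) hE'one
      hE'bimod (fun _ => rfl) (by rw [hEc]; exact hindep) c hX hT
    rw [hEc] at hfac
    have hsum : x + y = z c + z (!c) := by
      cases c
      exacts [add_comm x y, rfl]
    have hT_eq : T = Ring.inverse (b - z c) + Ring.inverse (b - z c) * (z (!c) * T) := by
      have h1 : (b - z c) * T = 1 + z (!c) * T := by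
        rw [← hTmul, hsum]
        noncomm_ring
      rw [← mul_one_add, ← h1, ← mul_assoc, Ring.inverse_mul_cancel _
        (isUnit_of_isStrictlyPositive_imagPart (him _ (hzsa c))), one_mul]
    constructor
    · conv_lhs => rw [hT_eq]
      rw [map_add, hfac.1, mul_one_add]
    · conv_lhs => rw [hT_eq]
      rw [map_add, hfac.2, mul_one_add, add_assoc]
  obtain ⟨hEx, hE'x⟩ := key true
  obtain ⟨hEy, hE'y⟩ := key false
  change E T = E (Ring.inverse (b - x)) * (1 + E (y * T)) at hEx
  change E T = E (Ring.inverse (b - y)) * (1 + E (x * T)) at hEy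
  change E' T = E' (Ring.inverse (b - x)) * (1 + E (y * T)) +
    E (Ring.inverse (b - x)) * E' (y * T) at hE'x
  change E' T = E' (Ring.inverse (b - y)) * (1 + E (x * T)) +
    E (Ring.inverse (b - y)) * E' (x * T) at hE'y
  have hbT : b * T = 1 + x * T + y * T := by
    rw [← hTmul]
    noncomm_ring
  have hbE : b * E T = 1 + E (x * T) + E (y * T) := by
    rw [← hbm, hbT, map_add, map_add, hEone]
  have hbE' : b * E' T = E' (x * T) + E' (y * T) := by
    rw [← hb'm, hbT, map_add, map_add, hE'one, zero_add]
  have hFGx : Fx * E (Ring.inverse (b - x)) = 1 := hFx ▸ Ring.inverse_mul_cancel _ (hunit x hx)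
  have hFGy : Fy * E (Ring.inverse (b - y)) = 1 := hFy ▸ Ring.inverse_mul_cancel _ (hunit y hy)
  have hFxT : Fx * E T = 1 + E (y * T) := by rw [hEx, ← mul_assoc, hFGx, one_mul]
  have hFyT : Fy * E T = 1 + E (x * T) := by rw [hEy, ← mul_assoc, hFGy, one_mul]
  have hKG : (Fx + Fy - b) * E T = 1 := by
    rw [sub_mul, add_mul, hFxT, hFyT, hbE]
    abel
  obtain ⟨u, hu⟩ : IsUnit (E T) := hunit _ (hx.add hy)
  have hK : Fx + Fy - b = ↑u⁻¹ := by
    rw [← hu] at hKG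
    exact (Units.inv_eq_of_mul_eq_one_left hKG).symm
  have hFxT' : Fx * E' T = Fx * E' (Ring.inverse (b - x)) * Fx * E T + E' (y * T) := by
    rw [mul_assoc _ Fx, hFxT, hE'x, mul_add, ← mul_assoc, ← mul_assoc, hFGx, one_mul]
  have hFyT' : Fy * E' T = Fy * E' (Ring.inverse (b - y)) * Fy * E T + E' (x * T) := by
    rw [mul_assoc _ Fy, hFyT, hE'y, mul_add, ← mul_assoc, ← mul_assoc, hFGy, one_mul]
  have hKg : (Fx + Fy - b) * E' T =
      (Fx * E' (Ring.inverse (b - x)) * Fx + Fy * E' (Ring.inverse (b - y)) * Fy) * E T := by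
    rw [sub_mul, add_mul, hFxT', hFyT', hbE']
    noncomm_ring
  refine ⟨hunit x hx, hunit y hy, hK ▸ u⁻¹.isUnit, ?_⟩
  rw [hK, Ring.inverse_unit, inv_inv, mul_assoc, hu, ← hKg, hK, ← hu, Units.mul_inv_cancel_left]
end
end

section
/- Let A be a unital C*-algebra, φ : A → ℂ a state, and φ' : A → ℂ a bounded self-adjoint linear functional with φ'(1) = 0. Let x,y ∈ A be self-adjoint elements which are infinitesimally Boolean independent with respect to (φ,φ'). Then for every z ∈ ℂ with Im z > 0: G_x(z) ≠ 0, G_y(z) ≠ 0, F_x(z) + F_y(z) − z ≠ 0, and g_{x+y}(z) = ( g_x(z) F_x(z)² + g_y(z) F_y(z)² ) / (F_x(z) + F_y(z) − z)². -/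
noncomputable section

open scoped BigOperators ComplexOrder

variable {A : Type*} [NormedRing A] [StarRing A] [CStarRing A] [CompleteSpace A]
  [NormedAlgebra ℂ A] [StarModule ℂ A]

/-- The Cauchy-transform-type quantity `ψ((z·1 - x)⁻¹)` associated to a functional
`ψ : A → ℂ`, a point `x ∈ A` and `z ∈ ℂ`. -/
def cauchyT (ψ : A → ℂ) (x : A) (z : ℂ) : ℂ := ψ (Ring.inverse (algebraMap ℂ A z - x))

/-- Two (non-unital) subalgebras `Sx`, `Sy` are infinitesimally Boolean independent with
respect to `(φ, φ')`: for every tuple `a_1, …, a_n` with consecutive entries belonging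
alternately to `Sx` and `Sy`, `φ(a_1⋯a_n) = φ(a_1)⋯φ(a_n)` and
`φ'(a_1⋯a_n) = Σ_j φ(a_1)⋯φ'(a_j)⋯φ(a_n)`. -/
def InfBooleanPairScalar (φ φ' : A → ℂ) (Sx Sy : Set A) : Prop :=
  ∀ n : ℕ, 0 < n → ∀ f : Fin n → Bool,
    (∀ (k : Fin n) (h : k.val + 1 < n), f k ≠ f ⟨k.val + 1, h⟩) →
    ∀ a : Fin n → A, (∀ k, a k ∈ if f k then Sx else Sy) →
      φ (List.ofFn a).prod = ∏ k, φ (a k) ∧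
      φ' (List.ofFn a).prod = ∑ j, φ' (a j) * ∏ k ∈ Finset.univ.erase j, φ (a k)

theorem IsSelfAdjoint.isUnit_algebraMap_sub {B : Type*} [CStarAlgebra B] {x : B}
    (hx : IsSelfAdjoint x) {z : ℂ} (hz : z.im ≠ 0) : IsUnit (algebraMap ℂ B z - x) := by
  by_contra h
  exact hz (hx.im_eq_zero_of_mem_spectrum (spectrum.mem_iff.mpr h))

theorem PositiveLinearMap.im_apply_eq_zero {B : Type*} [CStarAlgebra B] [PartialOrder B]
    [StarOrderedRing B] (φ : B →ₚ[ℂ] ℂ) {x : B} (hx : IsSelfAdjoint x) : (φ x).im = 0 := by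
  have h := (Complex.le_def.mp (φ.apply_le_of_isSelfAdjoint x hx)).2
  have h1 : 0 ≤ φ (algebraMap ℝ B ‖x‖) :=
    φ.map_nonneg (algebraMap_nonneg B (norm_nonneg x))
  rw [h, ← (Complex.le_def.mp h1).2, Complex.zero_im]

/-- A state sends the resolvent of a self-adjoint element at a point of the upper half-plane into
the lower half-plane. -/
theorem PositiveLinearMap.im_apply_resolvent_neg {B : Type*} [CStarAlgebra B] [PartialOrder B]
    [StarOrderedRing B] (φ : B →ₚ[ℂ] ℂ) (hφ : φ 1 = 1) {x : B} (hx : IsSelfAdjoint x)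
    {z : ℂ} (hz : 0 < z.im) : (φ (Ring.inverse (algebraMap ℂ B z - x))).im < 0 := by
  have hu := hx.isUnit_algebraMap_sub hz.ne'
  set s : B := algebraMap ℂ B z - x with hs
  set r : B := Ring.inverse s with hr
  have hsr : s * r = 1 := Ring.mul_inverse_cancel s hu
  have hrs : r * s = 1 := Ring.inverse_mul_cancel s hu
  have hstar : star s = algebraMap ℂ B (star z) - x := by
    rw [hs, star_sub, hx.star_eq, algebraMap_star_comm]
  have hss : star s * star r = 1 := by rw [← star_mul, hrs, star_one]
  have h1 : r = star z • (r * star r) - r * x * star r := by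
    calc r = r * (star s * star r) := by rw [hss, mul_one]
      _ = _ := by
        rw [hstar, sub_mul, mul_sub, ← mul_assoc r x, Algebra.algebraMap_eq_smul_one]
        simp
  have h2 : (φ (r * x * star r)).im = 0 := φ.im_apply_eq_zero (hx.conjugate r)
  have h3 : (φ (r * star r)).im = 0 := φ.im_apply_eq_zero (IsSelfAdjoint.mul_star_self r)
  have h4 : 0 < (φ (r * star r)).re := by
    have hle : r * (s * star s) * star r ≤ ‖s * star s‖ • (r * star r) :=
      CStarAlgebra.star_right_conjugate_le_norm_smul (IsSelfAdjoint.mul_star_self s)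
    have heq : r * (s * star s) * star r = 1 := by
      rw [← mul_assoc r, hrs, one_mul, hss]
    rw [heq] at hle
    have hle' := (Complex.le_def.mp (φ.monotone' hle)).1
    have h5 : φ (‖s * star s‖ • (r * star r)) = (‖s * star s‖ : ℂ) * φ (r * star r) := by
      rw [← Complex.coe_smul, map_smul, smul_eq_mul]
    change (φ 1).re ≤ (φ (‖s * star s‖ • (r * star r))).re at hle'
    rw [h5, hφ, Complex.re_ofReal_mul, Complex.one_re] at hle'
    by_contra hneg
    nlinarith [norm_nonneg (s * star s)]
  rw [h1, map_sub, map_smul, Complex.sub_im, h2, smul_eq_mul, Complex.mul_im, h3]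
  simp only [Complex.star_def, Complex.conj_im]
  nlinarith

/-- The alternating product with `n` factors `a`, `b`, starting with `a` if the flag is set and
with `b` otherwise. -/
def alternatingProd {M : Type*} [Monoid M] (a b : M) : Bool → ℕ → M
  | _, 0 => 1
  | s, n + 1 => (if s then a else b) * alternatingProd a b (!s) n

theorem alternatingProd_true_even {M : Type*} [Monoid M] (a b : M) (n : ℕ) :
    alternatingProd a b true (2 * n) = (a * b) ^ n := by
  induction n with
  | zero => simp [alternatingProd]
  | succ n ih => simp [Nat.mul_succ, alternatingProd, ih, pow_succ', mul_assoc]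

theorem alternatingProd_true_odd {M : Type*} [Monoid M] (a b : M) (n : ℕ) :
    alternatingProd a b true (2 * n + 1) = (a * b) ^ n * a := by
  induction n with
  | zero => simp [alternatingProd]
  | succ n ih =>
    rw [alternatingProd, Nat.mul_succ, alternatingProd, Bool.not_not, ih]
    simp [pow_succ', mul_assoc]

theorem alternatingProd_false_succ {M : Type*} [Monoid M] (a b : M) (n : ℕ) :
    alternatingProd a b false (n + 1) = b * alternatingProd a b true n := by
  simp [alternatingProd]

theorem prod_ofFn_alternating {M : Type*} [Monoid M] (a b : M) (s : Bool) (n : ℕ) :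
    (List.ofFn fun k : Fin n => if (s ^^ k.val.bodd) then a else b).prod =
      alternatingProd a b s n := by
  induction n generalizing s with
  | zero => simp [alternatingProd]
  | succ n ih =>
    rw [List.ofFn_succ, List.prod_cons, alternatingProd, ← ih]
    simp [Nat.bodd_succ]

theorem continuous_alternatingProd {M : Type*} [Monoid M] [TopologicalSpace M] [ContinuousMul M]
    (s : Bool) (n : ℕ) : Continuous fun p : M × M => alternatingProd p.1 p.2 s n := by
  induction n generalizing s with
  | zero => exact continuous_const
  | succ n ih =>
    cases s
    · exact continuous_snd.mul (ih _)
    · exact continuous_fst.mul (ih _)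

theorem dualNumber_prod {R ι : Type*} [CommRing R] [DecidableEq ι] (s : Finset ι) (u v : ι → R) :
    ∏ i ∈ s, (TrivSqZeroExt.inl (u i) + TrivSqZeroExt.inr (v i) : DualNumber R) =
      TrivSqZeroExt.inl (∏ i ∈ s, u i) +
        TrivSqZeroExt.inr (∑ j ∈ s, v j * ∏ k ∈ s.erase j, u k) := by
  induction s using Finset.induction_on with
  | empty => simp
  | insert a s ha ih =>
    rw [Finset.prod_insert ha, ih, Finset.prod_insert ha, Finset.sum_insert ha,
      Finset.erase_insert ha]
    have h : ∀ j ∈ s, v j * ∏ k ∈ (insert a s).erase j, u k =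
        u a * (v j * ∏ k ∈ s.erase j, u k) := fun j hj => by
      rw [Finset.erase_insert_of_ne (by rintro rfl; exact ha hj),
        Finset.prod_insert (fun h => ha (Finset.mem_of_mem_erase h))]
      ring
    rw [Finset.sum_congr rfl h, ← Finset.mul_sum]
    ext <;> simp
    ring

/-- The functional `φ + ε φ'` with values in the dual numbers. -/
def dualFunctional {B : Type*} [NormedRing B] [NormedAlgebra ℂ B] (φ φ' : B →L[ℂ] ℂ) :
    B →L[ℂ] DualNumber ℂ :=
  (TrivSqZeroExt.inlCLM ℂ ℂ).comp φ + (TrivSqZeroExt.inrCLM ℂ ℂ).comp φ'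

theorem dualFunctional_apply {B : Type*} [NormedRing B] [NormedAlgebra ℂ B]
    (φ φ' : B →L[ℂ] ℂ) (a : B) :
    dualFunctional φ φ' a = TrivSqZeroExt.inl (φ a) + TrivSqZeroExt.inr (φ' a) := rfl

theorem InfBooleanPairScalar.dualFunctional_alternatingProd {B : Type*} [NormedRing B]
    [NormedAlgebra ℂ B] {φ φ' : B →L[ℂ] ℂ} (hφ : φ 1 = 1) (hφ' : φ' 1 = 0) {Sx Sy : Set B}
    (h : InfBooleanPairScalar φ φ' Sx Sy) {a b : B} (ha : a ∈ Sx) (hb : b ∈ Sy)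
    (s : Bool) (n : ℕ) :
    dualFunctional φ φ' (alternatingProd a b s n) =
      alternatingProd (dualFunctional φ φ' a) (dualFunctional φ φ' b) s n := by
  rcases Nat.eq_zero_or_pos n with rfl | hn
  · simp [alternatingProd, dualFunctional_apply, hφ, hφ']
  obtain ⟨h1, h2⟩ := h n hn (fun k => s ^^ k.val.bodd)
    (fun k hk => by cases s <;> simp [Nat.bodd_succ])
    (fun k => if (s ^^ k.val.bodd) then a else b)
    (fun k => by split_ifs <;> assumption)
  rw [← prod_ofFn_alternating, ← prod_ofFn_alternating, dualFunctional_apply, h1, h2,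
    ← dualNumber_prod, List.prod_ofFn]
  refine Finset.prod_congr rfl fun k _ => ?_
  rw [← dualFunctional_apply]
  split_ifs <;> rfl

theorem InfBooleanPairScalar.dualFunctional_alternatingProd_closure {B : Type*} [NormedRing B]
    [NormedAlgebra ℂ B] {φ φ' : B →L[ℂ] ℂ} (hφ : φ 1 = 1) (hφ' : φ' 1 = 0) {Sx Sy : Set B}
    (h : InfBooleanPairScalar φ φ' Sx Sy) {a b : B} (ha : a ∈ closure Sx) (hb : b ∈ closure Sy)
    (s : Bool) (n : ℕ) :
    dualFunctional φ φ' (alternatingProd a b s n) =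
      alternatingProd (dualFunctional φ φ' a) (dualFunctional φ φ' b) s n := by
  have hψ := (dualFunctional φ φ').continuous
  have hclosed : IsClosed {p : B × B | dualFunctional φ φ' (alternatingProd p.1 p.2 s n) =
      alternatingProd (dualFunctional φ φ' p.1) (dualFunctional φ φ' p.2) s n} :=
    isClosed_eq (hψ.comp (continuous_alternatingProd s n))
      ((continuous_alternatingProd s n).comp (hψ.prodMap hψ))
  have hsub : Sx ×ˢ Sy ⊆ {p : B × B | dualFunctional φ φ' (alternatingProd p.1 p.2 s n) =
      alternatingProd (dualFunctional φ φ' p.1) (dualFunctional φ φ' p.2) s n} :=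
    fun p hp => h.dualFunctional_alternatingProd hφ hφ' hp.1 hp.2 s n
  have hmem : (a, b) ∈ closure (Sx ×ˢ Sy) := by
    rw [closure_prod_eq]
    exact ⟨ha, hb⟩
  exact closure_minimal hsub hclosed hmem

section AlternatingFunctional

variable {B D : Type*} [NormedRing B] [NormedAlgebra ℂ B] [CompleteSpace B] [CommRing D]
  [TopologicalSpace D] [IsTopologicalRing D] [T2Space D] [Algebra ℂ D]

theorem map_inverse_one_sub_mul_of_alternatingProd (ψ : B →L[ℂ] D) {a b : B}
    (hab : ‖a * b‖ < 1)
    (h : ∀ s n, ψ (alternatingProd a b s n) = alternatingProd (ψ a) (ψ b) s n) :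
    ψ (Ring.inverse (1 - a * b)) * (1 - ψ a * ψ b) = 1 ∧
    ψ ((1 + b) * Ring.inverse (1 - a * b) * (1 + a)) =
      (1 + ψ b) * ψ (Ring.inverse (1 - a * b)) * (1 + ψ a) := by
  have hpow : ∀ n, ψ ((a * b) ^ n) = (ψ a * ψ b) ^ n := fun n => by
    simpa only [alternatingProd_true_even] using h true (2 * n)
  have hpowa : ∀ n, ψ ((a * b) ^ n * a) = (ψ a * ψ b) ^ n * ψ a := fun n => by
    simpa only [alternatingProd_true_odd] using h true (2 * n + 1)
  have hbpow : ∀ n, ψ (b * (a * b) ^ n) = ψ b * (ψ a * ψ b) ^ n := fun n => by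
    simpa only [alternatingProd_false_succ, alternatingProd_true_even] using h false (2 * n + 1)
  have hbpowa : ∀ n, ψ (b * ((a * b) ^ n * a)) = ψ b * ((ψ a * ψ b) ^ n * ψ a) := fun n => by
    simpa only [alternatingProd_false_succ, alternatingProd_true_odd] using h false (2 * n + 1 + 1)
  have hS := hasSum_geom_series_inverse (a * b) hab
  set S := Ring.inverse (1 - a * b) with hSdef
  have hψS : HasSum (fun n => (ψ a * ψ b) ^ n) (ψ S) := by
    simpa only [hpow] using hS.mapL ψ
  have ha : ψ (S * a) = ψ S * ψ a := by
    refine HasSum.unique ?_ (hψS.mul_right (ψ a))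
    simpa only [hpowa] using (hS.mul_right a).mapL ψ
  have hb : ψ (b * S) = ψ b * ψ S := by
    refine HasSum.unique ?_ (hψS.mul_left (ψ b))
    simpa only [hbpow] using (hS.mul_left b).mapL ψ
  have hba : ψ (b * (S * a)) = ψ b * (ψ S * ψ a) := by
    refine HasSum.unique ?_ ((hψS.mul_right (ψ a)).mul_left (ψ b))
    simpa only [hbpowa] using ((hS.mul_right a).mul_left b).mapL ψ
  constructor
  · have h1 := (hψS.mul_right (ψ a * ψ b))
    have h2 : HasSum (fun n => (ψ a * ψ b) ^ n * (ψ a * ψ b)) (ψ S - 1) := by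
      have h3 := (hasSum_nat_add_iff' 1).mpr hψS
      simpa [pow_succ] using h3
    rw [mul_sub, h1.unique h2]
    ring
  · rw [show (1 + b) * S * (1 + a) = S + S * a + b * S + b * (S * a) by noncomm_ring]
    rw [map_add, map_add, map_add, ha, hb, hba]
    ring

end AlternatingFunctional

theorem inverse_one_sub_sub_one_mem_closure_adjoin {B : Type*} [NormedRing B] [NormedAlgebra ℂ B]
    [CompleteSpace B] (x : B) (c : ℂ) (hx : ‖c • x‖ < 1) :
    Ring.inverse (1 - c • x) - 1 ∈ closure (NonUnitalAlgebra.adjoin ℂ {x} : Set B) := by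
  have hS := (hasSum_nat_add_iff' 1).mpr (hasSum_geom_series_inverse (c • x) hx)
  simp only [Finset.range_one, Finset.sum_singleton, pow_zero] at hS
  have hcx : c • x ∈ NonUnitalAlgebra.adjoin ℂ {x} :=
    SMulMemClass.smul_mem c (NonUnitalAlgebra.subset_adjoin ℂ rfl)
  have hpow : ∀ n : ℕ, (c • x) ^ (n + 1) ∈ NonUnitalAlgebra.adjoin ℂ {x} := fun n => by
    induction n with
    | zero => simpa using hcx
    | succ n ih =>
      rw [pow_succ]
      exact mul_mem ih hcx
  exact mem_closure_of_tendsto hS.tendsto_sum_nat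
    (Filter.Eventually.of_forall fun n => sum_mem fun i _ => hpow i)

theorem norm_inverse_one_sub_sub_one_lt {B : Type*} [NormedRing B] [NormOneClass B]
    [CompleteSpace B] {u : B} (hu : ‖u‖ ≤ 1 / 4) : ‖Ring.inverse (1 - u) - 1‖ < 1 := by
  have hunit : IsUnit (1 - u) := isUnit_one_sub_of_norm_lt_one (by linarith)
  set a := Ring.inverse (1 - u) - 1 with ha
  have h1 : a = u * (1 + a) := by
    have h2 := Ring.mul_inverse_cancel _ hunit
    rw [ha, add_sub_cancel, ← sub_eq_zero, ← sub_eq_zero.mpr h2]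
    noncomm_ring
  have h2 : ‖a‖ ≤ ‖u‖ * (1 + ‖a‖) := by
    calc ‖a‖ = ‖u * (1 + a)‖ := by rw [← h1]
      _ ≤ ‖u‖ * ‖1 + a‖ := norm_mul_le _ _
      _ ≤ ‖u‖ * (‖(1 : B)‖ + ‖a‖) := by gcongr; exact norm_add_le _ _
      _ = _ := by rw [norm_one]
  nlinarith [norm_nonneg a]

theorem inverse_algebraMap_sub {B : Type*} [Ring B] [Algebra ℂ B] (x : B) {z : ℂ}
    (hz : z ≠ 0) :
    Ring.inverse (algebraMap ℂ B z - x) = z⁻¹ • Ring.inverse (1 - z⁻¹ • x) := by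
  have h : algebraMap ℂ B z - x = algebraMap ℂ B z * (1 - z⁻¹ • x) := by
    rw [mul_sub, mul_one, ← Algebra.smul_def, smul_smul, mul_inv_cancel₀ hz, one_smul]
  have h1 : algebraMap ℂ B z * algebraMap ℂ B z⁻¹ = 1 := by
    rw [← map_mul, mul_inv_cancel₀ hz, map_one]
  have h2 : algebraMap ℂ B z⁻¹ * algebraMap ℂ B z = 1 := by
    rw [← map_mul, inv_mul_cancel₀ hz, map_one]
  have h3 : Ring.inverse (algebraMap ℂ B z) = algebraMap ℂ B z⁻¹ :=
    Ring.inverse_unit (⟨_, _, h1, h2⟩ : Bˣ)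
  rw [h, Ring.mul_inverse_rev' (Algebra.commute_algebraMap_left z _), h3, ← Algebra.commutes,
    ← Algebra.smul_def]

theorem inverse_one_sub_add {B : Type*} [Ring B] {u v : B} (hu : IsUnit (1 - u))
    (hv : IsUnit (1 - v))
    (huv : IsUnit (1 - (Ring.inverse (1 - u) - 1) * (Ring.inverse (1 - v) - 1))) :
    Ring.inverse (1 - (u + v)) = Ring.inverse (1 - v) *
      Ring.inverse (1 - (Ring.inverse (1 - u) - 1) * (Ring.inverse (1 - v) - 1)) *
        Ring.inverse (1 - u) := by
  obtain ⟨U, hU⟩ := hu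
  obtain ⟨V, hV⟩ := hv
  obtain ⟨T, hT⟩ := huv
  have h : 1 - (u + v) = ((U * T * V : Bˣ) : B) := by
    have hUinv : (U : B) * Ring.inverse (1 - u) = 1 := by
      rw [← hU, Ring.inverse_unit, Units.mul_inv]
    have hVinv : Ring.inverse (1 - v) * (V : B) = 1 := by
      rw [← hV, Ring.inverse_unit, Units.inv_mul]
    calc 1 - (u + v) = (1 - u) + (1 - v) - 1 := by noncomm_ring
      _ = (U : B) * V - (U * Ring.inverse (1 - u) - U) * (Ring.inverse (1 - v) * V - V) := by
        rw [hUinv, hVinv, ← hU, ← hV]; noncomm_ring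
      _ = _ := by
        rw [Units.val_mul, Units.val_mul, hT]; noncomm_ring
  rw [h, Ring.inverse_unit, ← hT, ← hU, ← hV]
  simp only [Ring.inverse_unit, mul_inv_rev, Units.val_mul, mul_assoc]

/-- Boolean additive convolution in the dual numbers, far away from the spectra. -/
theorem InfBooleanPairScalar.dualFunctional_resolvent {B : Type*} [NormedRing B]
    [NormedAlgebra ℂ B] [NormOneClass B] [CompleteSpace B] {φ φ' : B →L[ℂ] ℂ} (hφ : φ 1 = 1)
    (hφ' : φ' 1 = 0) {x y : B}
    (h : InfBooleanPairScalar φ φ'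
      (NonUnitalAlgebra.adjoin ℂ {x} : Set B) (NonUnitalAlgebra.adjoin ℂ {y} : Set B))
    {z : ℂ} (hz : z ≠ 0) (hxz : 4 * ‖x‖ ≤ ‖z‖) (hyz : 4 * ‖y‖ ≤ ‖z‖) :
    dualFunctional φ φ' (Ring.inverse (algebraMap ℂ B z - (x + y))) *
      (dualFunctional φ φ' (Ring.inverse (algebraMap ℂ B z - x)) +
        dualFunctional φ φ' (Ring.inverse (algebraMap ℂ B z - y)) -
        z • (dualFunctional φ φ' (Ring.inverse (algebraMap ℂ B z - x)) *
          dualFunctional φ φ' (Ring.inverse (algebraMap ℂ B z - y)))) =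
      dualFunctional φ φ' (Ring.inverse (algebraMap ℂ B z - x)) *
        dualFunctional φ φ' (Ring.inverse (algebraMap ℂ B z - y)) := by
  have hz' : 0 < ‖z‖ := norm_pos_iff.mpr hz
  have hsmul : ∀ w : B, 4 * ‖w‖ ≤ ‖z‖ → ‖z⁻¹ • w‖ ≤ 1 / 4 := fun w hw => by
    rw [norm_smul, norm_inv, inv_mul_le_iff₀ hz']
    linarith
  have hx := hsmul x hxz
  have hy := hsmul y hyz
  have hψ1 : dualFunctional φ φ' 1 = 1 := by simp [dualFunctional_apply, hφ, hφ']
  have hab := mul_lt_one_of_nonneg_of_lt_one_left (norm_nonneg _)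
    (norm_inverse_one_sub_sub_one_lt hx) (norm_inverse_one_sub_sub_one_lt hy).le
  replace hab := (norm_mul_le _ _).trans_lt hab
  obtain ⟨h1, h2⟩ := map_inverse_one_sub_mul_of_alternatingProd (dualFunctional φ φ') hab
    (h.dualFunctional_alternatingProd_closure hφ hφ'
      (inverse_one_sub_sub_one_mem_closure_adjoin x z⁻¹ (by linarith))
      (inverse_one_sub_sub_one_mem_closure_adjoin y z⁻¹ (by linarith)))
  rw [inverse_algebraMap_sub x hz, inverse_algebraMap_sub y hz, inverse_algebraMap_sub _ hz,
    smul_add, inverse_one_sub_add (isUnit_one_sub_of_norm_lt_one (by linarith))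
      (isUnit_one_sub_of_norm_lt_one (by linarith)) (isUnit_one_sub_of_norm_lt_one hab)]
  simp only [add_sub_cancel, map_sub, hψ1] at h1 h2
  simp only [map_smul, h2]
  generalize dualFunctional φ φ' (Ring.inverse (1 - z⁻¹ • x)) = P at *
  generalize dualFunctional φ φ' (Ring.inverse (1 - z⁻¹ • y)) = Q at *
  generalize dualFunctional φ φ' (Ring.inverse _) = S at *
  simp only [Algebra.smul_def]
  have hc : algebraMap ℂ (DualNumber ℂ) z * algebraMap ℂ (DualNumber ℂ) z⁻¹ = 1 := by
    rw [← map_mul, mul_inv_cancel₀ hz, map_one]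
  generalize algebraMap ℂ (DualNumber ℂ) z = Z at *
  generalize algebraMap ℂ (DualNumber ℂ) z⁻¹ = c at *
  linear_combination (c ^ 2 * P * Q) * h1 - (c ^ 2 * P ^ 2 * Q ^ 2 * S) * hc

theorem differentiableOn_cauchyT {B : Type*} [CStarAlgebra B] (ψ : B →L[ℂ] ℂ) {x : B}
    (hx : IsSelfAdjoint x) : DifferentiableOn ℂ (cauchyT ψ x) {z : ℂ | 0 < z.im} := by
  intro z hz
  have h1 : DifferentiableAt ℂ (fun z : ℂ => algebraMap ℂ B z - x) z :=
    ((Algebra.linearMap ℂ B).toContinuousLinearMap.differentiableAt).sub_const x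
  have h2 := differentiableAt_inverse (𝕜 := ℂ) (hx.isUnit_algebraMap_sub (ne_of_gt hz))
  exact (ψ.differentiableAt.comp z (h2.comp z h1)).differentiableWithinAt

theorem eqOn_upperHalfPlane_of_eq_of_le_norm {f g : ℂ → ℂ}
    (hf : DifferentiableOn ℂ f {z : ℂ | 0 < z.im}) (hg : DifferentiableOn ℂ g {z : ℂ | 0 < z.im})
    (C : ℝ) (h : ∀ z : ℂ, 0 < z.im → C ≤ ‖z‖ → f z = g z) :
    Set.EqOn f g {z : ℂ | 0 < z.im} := by
  have ho : IsOpen {z : ℂ | 0 < z.im} := isOpen_lt continuous_const Complex.continuous_im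
  have hz₀ : ((|C| + 1 : ℝ) * Complex.I : ℂ) ∈ {z : ℂ | 0 < z.im} := by
    simp only [Set.mem_ofPred_eq, Complex.im_ofReal_mul, Complex.I_im]
    positivity
  refine (hf.analyticOnNhd ho).eqOn_of_preconnected_of_eventuallyEq (hg.analyticOnNhd ho)
    (convex_halfSpace_im_gt 0).isPreconnected hz₀ ?_
  have hC : ∀ᶠ z in nhds ((|C| + 1 : ℝ) * Complex.I : ℂ), C < ‖z‖ := by
    refine continuous_norm.continuousAt.eventually (lt_mem_nhds ?_)
    dsimp only
    rw [norm_mul, Complex.norm_I, mul_one, Complex.norm_real, Real.norm_eq_abs]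
    exact (by linarith [le_abs_self C] : C < |C| + 1).trans_le (le_abs_self _)
  filter_upwards [ho.mem_nhds hz₀, hC] with z hz hzC using h z hz hzC.le

theorem InfBooleanPairScalar.cauchyT_identities {B : Type*} [CStarAlgebra B] [Nontrivial B]
    {φ φ' : B →L[ℂ] ℂ} (hφ : φ 1 = 1) (hφ' : φ' 1 = 0) {x y : B} (hx : IsSelfAdjoint x)
    (hy : IsSelfAdjoint y)
    (h : InfBooleanPairScalar φ φ'
      (NonUnitalAlgebra.adjoin ℂ {x} : Set B) (NonUnitalAlgebra.adjoin ℂ {y} : Set B))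
    {z : ℂ} (hz : 0 < z.im) :
    cauchyT φ (x + y) z * (cauchyT φ x z + cauchyT φ y z - z * (cauchyT φ x z * cauchyT φ y z)) =
      cauchyT φ x z * cauchyT φ y z ∧
    cauchyT φ' (x + y) z *
        (cauchyT φ x z + cauchyT φ y z - z * (cauchyT φ x z * cauchyT φ y z)) +
      cauchyT φ (x + y) z * (cauchyT φ' x z + cauchyT φ' y z -
        z * (cauchyT φ x z * cauchyT φ' y z + cauchyT φ' x z * cauchyT φ y z)) =
      cauchyT φ x z * cauchyT φ' y z + cauchyT φ' x z * cauchyT φ y z := by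
  have hGx := differentiableOn_cauchyT φ hx
  have hGy := differentiableOn_cauchyT φ hy
  have hG := differentiableOn_cauchyT φ (hx.add hy)
  have hgx := differentiableOn_cauchyT φ' hx
  have hgy := differentiableOn_cauchyT φ' hy
  have hg := differentiableOn_cauchyT φ' (hx.add hy)
  have key := fun (w : ℂ) (hw : 0 < w.im) (hwC : 4 * (‖x‖ + ‖y‖) ≤ ‖w‖) =>
    h.dualFunctional_resolvent hφ hφ' (z := w) (by rintro rfl; simp at hw)
      (by linarith [norm_nonneg y]) (by linarith [norm_nonneg x])
  constructor
  · refine eqOn_upperHalfPlane_of_eq_of_le_norm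
      (f := fun z => cauchyT φ (x + y) z *
        (cauchyT φ x z + cauchyT φ y z - z * (cauchyT φ x z * cauchyT φ y z)))
      (g := fun z => cauchyT φ x z * cauchyT φ y z) (by fun_prop) (by fun_prop)
      (4 * (‖x‖ + ‖y‖)) (fun w hw hwC => ?_) hz
    simpa [dualFunctional_apply, cauchyT] using congrArg TrivSqZeroExt.fst (key w hw hwC)
  · refine eqOn_upperHalfPlane_of_eq_of_le_norm
      (f := fun z => cauchyT φ' (x + y) z *
          (cauchyT φ x z + cauchyT φ y z - z * (cauchyT φ x z * cauchyT φ y z)) +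
        cauchyT φ (x + y) z * (cauchyT φ' x z + cauchyT φ' y z -
          z * (cauchyT φ x z * cauchyT φ' y z + cauchyT φ' x z * cauchyT φ y z)))
      (g := fun z => cauchyT φ x z * cauchyT φ' y z + cauchyT φ' x z * cauchyT φ y z)
      (by fun_prop) (by fun_prop) (4 * (‖x‖ + ‖y‖)) (fun w hw hwC => ?_) hz
    have h1 := congrArg TrivSqZeroExt.snd (key w hw hwC)
    simp [dualFunctional_apply] at h1
    simp only [cauchyT]
    linear_combination h1

/-- Theorem (scalar infinitesimal Boolean additive convolution): for a unital C*-algebra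
`A`, a state `φ`, a bounded self-adjoint functional `φ'` with `φ'(1) = 0`, and
self-adjoint `x`, `y` infinitesimally Boolean independent with respect to `(φ, φ')`, for
every `z` in the upper half-plane: `G_x(z) ≠ 0`, `G_y(z) ≠ 0`, `F_x(z)+F_y(z)-z ≠ 0` and
`g_{x+y}(z) = (g_x(z) F_x(z)² + g_y(z) F_y(z)²) / (F_x(z)+F_y(z)-z)²`. -/
theorem scalar_infinitesimal_boolean_convolution
    (φ : A →ₗ[ℂ] ℂ) (hφ1 : φ 1 = 1) (hφpos : ∀ a : A, 0 ≤ φ (star a * a))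
    (φ' : A →L[ℂ] ℂ) (hφ'1 : φ' 1 = 0)
    (hφ'sa : ∀ a : A, φ' (star a) = starRingEnd ℂ (φ' a))
    (x y : A) (hx : IsSelfAdjoint x) (hy : IsSelfAdjoint y)
    (hindep : InfBooleanPairScalar ⇑φ ⇑φ'
      (NonUnitalAlgebra.adjoin ℂ {x} : Set A) (NonUnitalAlgebra.adjoin ℂ {y} : Set A))
    (z : ℂ) (hz : 0 < z.im) :
    cauchyT ⇑φ x z ≠ 0 ∧ cauchyT ⇑φ y z ≠ 0 ∧
    (cauchyT ⇑φ x z)⁻¹ + (cauchyT ⇑φ y z)⁻¹ - z ≠ 0 ∧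
    cauchyT ⇑φ' (x + y) z =
      (cauchyT ⇑φ' x z * ((cauchyT ⇑φ x z)⁻¹) ^ 2 +
        cauchyT ⇑φ' y z * ((cauchyT ⇑φ y z)⁻¹) ^ 2) /
      ((cauchyT ⇑φ x z)⁻¹ + (cauchyT ⇑φ y z)⁻¹ - z) ^ 2 := by
  let : CStarAlgebra A := {}
  let : PartialOrder A := CStarAlgebra.spectralOrder A
  have : StarOrderedRing A := CStarAlgebra.spectralOrderedRing A
  have : Nontrivial A := ⟨1, 0, fun h => by simp [h] at hφ1⟩
  let φp : A →ₚ[ℂ] ℂ := PositiveLinearMap.mk₀ φ fun a ha => by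
    obtain ⟨b, rfl⟩ := CStarAlgebra.nonneg_iff_eq_star_mul_self.mp ha
    exact hφpos b
  have hcont : Continuous φp := map_continuous φp
  let φc : A →L[ℂ] ℂ := ⟨φ, hcont⟩
  have hG : ∀ w : A, IsSelfAdjoint w → cauchyT φ w z ≠ 0 := fun w hw h0 => by
    have h1 : (cauchyT φ w z).im < 0 := φp.im_apply_resolvent_neg hφ1 hw hz
    simp [h0] at h1
  have hGx := hG x hx
  have hGy := hG y hy
  obtain ⟨h1, h2⟩ := InfBooleanPairScalar.cauchyT_identities (φ := φc) (φ' := φ') hφ1 hφ'1 hx hy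
    hindep hz
  change cauchyT φ (x + y) z * (cauchyT φ x z + cauchyT φ y z -
    z * (cauchyT φ x z * cauchyT φ y z)) = cauchyT φ x z * cauchyT φ y z at h1
  change cauchyT φ' (x + y) z * (cauchyT φ x z + cauchyT φ y z -
      z * (cauchyT φ x z * cauchyT φ y z)) +
    cauchyT φ (x + y) z * (cauchyT φ' x z + cauchyT φ' y z -
      z * (cauchyT φ x z * cauchyT φ' y z + cauchyT φ' x z * cauchyT φ y z)) =
    cauchyT φ x z * cauchyT φ' y z + cauchyT φ' x z * cauchyT φ y z at h2
  generalize cauchyT φ x z = Gx at *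
  generalize cauchyT φ y z = Gy at *
  generalize cauchyT φ (x + y) z = G at *
  generalize cauchyT φ' x z = gx at *
  generalize cauchyT φ' y z = gy at *
  generalize cauchyT φ' (x + y) z = g at *
  have hD : Gx + Gy - z * (Gx * Gy) ≠ 0 := fun h0 => by
    rw [h0, mul_zero] at h1
    exact mul_ne_zero hGx hGy h1.symm
  have hF : Gx⁻¹ + Gy⁻¹ - z = (Gx + Gy - z * (Gx * Gy)) / (Gx * Gy) := by
    field_simp
    ring
  refine ⟨hGx, hGy, ?_, ?_⟩
  · rw [hF]
    exact div_ne_zero hD (mul_ne_zero hGx hGy)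
  · have hg : g = (gx * Gy ^ 2 + gy * Gx ^ 2) / (Gx + Gy - z * (Gx * Gy)) ^ 2 := by
      rw [eq_div_iff (pow_ne_zero 2 hD)]
      linear_combination (Gx + Gy - z * (Gx * Gy)) * h2 -
        (gx + gy - z * (Gx * gy + gx * Gy)) * h1
    rw [hF, hg]
    field_simp
end
end

section
/- Let (M,φ,φ') be an infinitesimal probability space, N ≥ 1, and for r = 1,…,k let {a^{(r)}_{i,j} : 1 ≤ i,j ≤ N} ⊆ M be families of elements such that the non-unital subalgebras of M generated by these families are infinitesimally Boolean independent with respect to (φ,φ'). Form the matrices A^{(r)} = [a^{(r)}_{i,j}]_{i,j=1}^N ∈ M_N(M), and consider the operator-valued infinitesimal probability space (M_N(M), M_N(ℂ), E, E') where E = φ applied entrywise and E' = φ' applied entrywise. Then A^{(1)},…,A^{(k)} are infinitesimally Boolean independent over M_N(ℂ): writing 𝒜_r for the M_N(ℂ)-bimodule subalgebra of M_N(M) generated by A^{(r)} (spanned by products C_0 A^{(r)} C_1 A^{(r)} ⋯ A^{(r)} C_m with C_i ∈ M_N(ℂ), m ≥ 1), for every n ≥ 1, all indices r_1,…,r_n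 with r_1 ≠ r_2, …, r_{n−1} ≠ r_n, and all X_j ∈ 𝒜_{r_j}: E(X_1⋯X_n) = E(X_1)⋯E(X_n) and E'(X_1⋯X_n) = Σ_{j=1}^n E(X_1)⋯E(X_{j−1})E'(X_j)E(X_{j+1})⋯E(X_n). -/
noncomputable section

open scoped BigOperators

variable {M : Type*} [Ring M] [Algebra ℂ M]

/-- Non-unital subalgebras (given as sets) `S i` of `M` are infinitesimally Boolean
independent with respect to `(φ, φ')`: for adjacent-distinct indices and `x_j ∈ S i_j`,
`φ(x_1⋯x_n) = φ(x_1)⋯φ(x_n)` and `φ'(x_1⋯x_n) = Σ_j φ(x_1)⋯φ'(x_j)⋯φ(x_n)`. -/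
def InfBooleanIndepFam {I : Type*} (φ φ' : M → ℂ) (S : I → Set M) : Prop :=
  ∀ n : ℕ, 0 < n → ∀ idx : Fin n → I,
    (∀ (k : Fin n) (h : k.val + 1 < n), idx k ≠ idx ⟨k.val + 1, h⟩) →
    ∀ x : Fin n → M, (∀ k, x k ∈ S (idx k)) →
      φ (List.ofFn x).prod = ∏ k, φ (x k) ∧
      φ' (List.ofFn x).prod = ∑ j, φ' (x j) * ∏ k ∈ Finset.univ.erase j, φ (x k)

/-- The `M_N(ℂ)`-bimodule subalgebra of `M_N(M)` generated by a matrix `X`: the linear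
span of the products `C₀ X C₁ X ⋯ X C_m` with `m ≥ 1` and `C_i ∈ M_N(ℂ)`. -/
def matGenAlg {N : ℕ} (X : Matrix (Fin N) (Fin N) M) :
    Submodule ℂ (Matrix (Fin N) (Fin N) M) :=
  Submodule.span ℂ
    {Y | ∃ m : ℕ, 0 < m ∧ ∃ C : Fin (m + 1) → Matrix (Fin N) (Fin N) ℂ,
      Y = (List.ofFn fun i : Fin m =>
            (C i.castSucc).map (algebraMap ℂ M) * X).prod *
          (C (Fin.last m)).map (algebraMap ℂ M)}

/-- An entry of a product of square matrices is a sum over index paths. -/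
theorem Matrix.list_prod_ofFn_apply {R : Type*} [Semiring R] {ι : Type*} [Fintype ι]
    [DecidableEq ι] (n : ℕ) (X : Fin n → Matrix ι ι R) (i i' : ι) :
    (List.ofFn X).prod i i' = ∑ p : Fin (n + 1) → ι,
      if p 0 = i ∧ p (Fin.last n) = i' then
        (List.ofFn fun j => X j (p j.castSucc) (p j.succ)).prod else 0 := by
  induction n generalizing i with
  | zero =>
    rw [← (Equiv.funUnique (Fin 1) ι).symm.sum_comp]
    by_cases h : i = i'
    · subst h
      simp
    · simp only [List.ofFn_zero, List.prod_nil, Matrix.one_apply_ne h]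
      symm
      refine Finset.sum_eq_zero fun x _ => if_neg ?_
      rintro ⟨h₁, h₂⟩
      exact h (h₁.symm.trans h₂)
  | succ n ih =>
    rw [← (Fin.consEquiv fun _ => ι).sum_comp, Fintype.sum_prod_type]
    rw [Finset.sum_eq_single i]
    · rw [List.ofFn_succ, List.prod_cons, Matrix.mul_apply]
      simp only [ih, Finset.mul_sum]
      rw [Finset.sum_comm]
      refine Finset.sum_congr rfl fun p _ => ?_
      rw [Finset.sum_eq_single (p 0)]
      · change _ = if i = i ∧ p (Fin.last n) = i' then _ else _
        simp only [true_and, mul_ite, mul_zero, List.ofFn_succ, List.prod_cons]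
        rfl
      · intro b _ hb
        rw [if_neg fun h => hb h.1.symm, mul_zero]
      · simp
    · intro b _ hb
      exact Finset.sum_eq_zero fun p _ => if_neg fun h => hb h.1
    · simp

theorem Matrix.mul_map_algebraMap_apply_mem {N : ℕ} (S : NonUnitalSubalgebra ℂ M)
    {Y : Matrix (Fin N) (Fin N) M} (hY : ∀ i i', Y i i' ∈ S)
    (C : Matrix (Fin N) (Fin N) ℂ) (i i' : Fin N) :
    (Y * C.map (algebraMap ℂ M)) i i' ∈ S := by
  rw [Matrix.mul_apply]
  refine sum_mem fun l _ => ?_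
  rw [Matrix.map_apply, ← Algebra.commutes, ← Algebra.smul_def]
  exact SMulMemClass.smul_mem _ (hY _ _)

theorem Matrix.map_algebraMap_mul_apply_mem {N : ℕ} (S : NonUnitalSubalgebra ℂ M)
    {Y : Matrix (Fin N) (Fin N) M} (hY : ∀ i i', Y i i' ∈ S)
    (C : Matrix (Fin N) (Fin N) ℂ) (i i' : Fin N) :
    (C.map (algebraMap ℂ M) * Y) i i' ∈ S := by
  rw [Matrix.mul_apply]
  refine sum_mem fun l _ => ?_
  rw [Matrix.map_apply, ← Algebra.smul_def]
  exact SMulMemClass.smul_mem _ (hY _ _)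

theorem Matrix.list_prod_ofFn_succ_apply_mem {N : ℕ} (S : NonUnitalSubalgebra ℂ M) (m : ℕ)
    (Y : Fin (m + 1) → Matrix (Fin N) (Fin N) M) (hY : ∀ j i i', Y j i i' ∈ S)
    (i i' : Fin N) : (List.ofFn Y).prod i i' ∈ S := by
  induction m generalizing i with
  | zero => simpa using hY 0 i i'
  | succ m ih =>
    rw [List.ofFn_succ, List.prod_cons, Matrix.mul_apply]
    exact sum_mem fun l _ => S.mul_mem (hY _ _ _) (ih _ (fun j => hY j.succ) l)

/-- Entries of matrices in the bimodule algebra generated by `X` lie in any non-unital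
subalgebra containing the entries of `X`. -/
theorem matGenAlg_apply_mem {N : ℕ} (S : NonUnitalSubalgebra ℂ M)
    {X : Matrix (Fin N) (Fin N) M} (hX : ∀ i i', X i i' ∈ S)
    {Y : Matrix (Fin N) (Fin N) M} (hY : Y ∈ matGenAlg X) (i i' : Fin N) : Y i i' ∈ S := by
  induction hY using Submodule.span_induction with
  | mem Y h =>
    obtain ⟨m, hm, C, rfl⟩ := h
    obtain ⟨m, rfl⟩ := Nat.exists_eq_succ_of_ne_zero hm.ne'
    exact Matrix.mul_map_algebraMap_apply_mem S
      (Matrix.list_prod_ofFn_succ_apply_mem S m _ fun _ =>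
        Matrix.map_algebraMap_mul_apply_mem S hX _) _ i i'
  | zero => exact S.zero_mem
  | add Y Z _ _ hY hZ => exact S.add_mem hY hZ
  | smul c Y _ hY => exact SMulMemClass.smul_mem c hY

/-- Theorem: if the families `{a^{(r)}_{i,j}}` generate infinitesimally Boolean
independent non-unital subalgebras of `(M, φ, φ')`, then the matrices
`A^{(r)} = [a^{(r)}_{i,j}]` are infinitesimally Boolean independent over `M_N(ℂ)` in
`(M_N(M), M_N(ℂ), E, E')` where `E = φ` and `E' = φ'` applied entrywise. -/
theorem matrices_of_infBoolean_are_infBoolean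
    (φ φ' : M →ₗ[ℂ] ℂ) (hφ1 : φ 1 = 1) (hφ'1 : φ' 1 = 0)
    (N : ℕ) (hN : 1 ≤ N) (k : ℕ) (a : Fin k → Fin N → Fin N → M)
    (hindep : InfBooleanIndepFam ⇑φ ⇑φ' fun r =>
      (NonUnitalAlgebra.adjoin ℂ (Set.range fun p : Fin N × Fin N => a r p.1 p.2) : Set M)) :
    ∀ n : ℕ, 0 < n → ∀ idx : Fin n → Fin k,
      (∀ (j : Fin n) (h : j.val + 1 < n), idx j ≠ idx ⟨j.val + 1, h⟩) →
      ∀ X : Fin n → Matrix (Fin N) (Fin N) M,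
        (∀ j, X j ∈ matGenAlg (Matrix.of fun i i' => a (idx j) i i')) →
        (List.ofFn X).prod.map ⇑φ = (List.ofFn fun j => (X j).map ⇑φ).prod ∧
        (List.ofFn X).prod.map ⇑φ' =
          ∑ j : Fin n,
            (List.ofFn fun r => if r = j then (X r).map ⇑φ' else (X r).map ⇑φ).prod := by
  intro n hn idx hidx X hX
  have hmem (j : Fin n) (i i' : Fin N) :
      X j i i' ∈ NonUnitalAlgebra.adjoin ℂ
        (Set.range fun p : Fin N × Fin N => a (idx j) p.1 p.2) :=
    matGenAlg_apply_mem _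
      (fun i i' => by exact NonUnitalAlgebra.subset_adjoin ℂ ⟨(i, i'), rfl⟩) (hX j) i i'
  have key (p : Fin (n + 1) → Fin N) :=
    hindep n hn idx hidx (fun j => X j (p j.castSucc) (p j.succ)) fun j => hmem j _ _
  constructor
  · ext i i'
    rw [Matrix.map_apply, Matrix.list_prod_ofFn_apply, Matrix.list_prod_ofFn_apply, map_sum]
    refine Finset.sum_congr rfl fun p _ => ?_
    split_ifs
    · rw [(key p).1, List.prod_ofFn]
      rfl
    · exact map_zero φ
  · ext i i'
    rw [Matrix.map_apply, Matrix.list_prod_ofFn_apply, Matrix.sum_apply, map_sum]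
    simp only [Matrix.list_prod_ofFn_apply]
    rw [Finset.sum_comm]
    refine Finset.sum_congr rfl fun p _ => ?_
    split_ifs
    · rw [(key p).2]
      refine Finset.sum_congr rfl fun j _ => ?_
      rw [List.prod_ofFn, ← Finset.mul_prod_erase _ _ (Finset.mem_univ j), if_pos rfl]
      congr 1
      refine Finset.prod_congr rfl fun l hl => ?_
      rw [if_neg (Finset.ne_of_mem_erase hl)]
      rfl
    · simp
end
end

section
/- Let (M,φ,φ') be an infinitesimal probability space, N ≥ 1, and consider the operator-valued infinitesimal probability space (M_N(M), M_N(ℂ), E, E') where E = φ applied entrywise and E' = φ' applied entrywise. Then for every n ≥ 1 and all matrices X^{(1)} = [x^{(1)}_{i,j}],…,X^{(n)} = [x^{(n)}_{i,j}] ∈ M_N(M), the operator-valued infinitesimal Boolean cumulants satisfy, entrywise for all 1 ≤ i,j ≤ N: [∂β_n(X^{(1)},…,X^{(n)})]_{i,j} = Σ_{i_2,…,i_n = 1}^{N} β'_n( x^{(1)}_{i,i_2}, x^{(2)}_{i_2,i_3}, …, x^{(n)}_{i_n,j} ), where β'_n denotes the scalar infinitesimal Boolean cumulant of (M,φ,φ').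 -/
noncomputable section

open scoped BigOperators

/-- For a composition `c` of `n` (encoding an interval partition of `{1,…,n}`) and maps
`E, E'` into a ring `R`, `∂E_c(x₁,…,xₙ) = Σ_s` (the ordered product of `E` applied to the
consecutive blocks, with the `s`-th factor `E` replaced by `E'`). -/
def dmomComp {M R : Type*} [Ring M] [Ring R] (E E' : M → R) {n : ℕ}
    (c : Composition n) (x : Fin n → M) : R :=
  ∑ s : Fin c.length,
    (List.ofFn fun i : Fin c.length =>
      (if i = s then E' else E)
        (List.ofFn fun j : Fin (c.blocksFun i) => x (c.embedding i j)).prod).prod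

/-- The infinitesimal Boolean cumulants associated to a moment pair `(E, E')`:
`∂β_n(x₁,…,xₙ) = Σ_{c composition of n} (−1)^{r(c)−1} ∂E_c(x₁,…,xₙ)`. -/
def dBooCum {M R : Type*} [Ring M] [Ring R] [Module ℂ R] (E E' : M → R) (n : ℕ)
    (x : Fin n → M) : R :=
  ∑ c : Composition n, ((-1 : ℂ) ^ (c.length - 1)) • dmomComp E E' c x

/-- The sum of `g [A₁ a k₁, A₂ k₁ k₂, …, Aₘ kₘ₋₁ b]` over all index paths from `a` to `b`
along the list of matrices `[A₁, …, Aₘ]`. -/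
def pathSum {ι M R : Type*} [Fintype ι] [DecidableEq ι] [Ring R] :
    List (Matrix ι ι M) → (List M → R) → ι → ι → R
  | [], g, a, b => if a = b then g [] else 0
  | A :: l, g, a, b => ∑ k, pathSum l (fun t => g (A a k :: t)) k b

section PathSum

variable {ι M R : Type*} [Fintype ι] [DecidableEq ι] [Ring R]

theorem pathSum_const_mul (l : List (Matrix ι ι M)) (r : R) (g : List M → R) (a b : ι) :
    pathSum l (fun t => r * g t) a b = r * pathSum l g a b := by
  induction l generalizing g a with
  | nil => simp [pathSum]
  | cons A l ih => simp only [pathSum, Finset.mul_sum, ih]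

theorem pathSum_append (l₁ l₂ : List (Matrix ι ι M)) (g₁ g₂ : List M → R) (a b : ι) :
    pathSum (l₁ ++ l₂) (fun t => g₁ (t.take l₁.length) * g₂ (t.drop l₁.length)) a b =
      ∑ k, pathSum l₁ g₁ a k * pathSum l₂ g₂ k b := by
  induction l₁ generalizing g₁ a with
  | nil => simp [pathSum, pathSum_const_mul]
  | cons A l ih =>
    simp only [pathSum, List.cons_append, List.length_cons, List.take_succ_cons,
      List.drop_succ_cons, Finset.sum_mul]
    rw [Finset.sum_comm]
    exact Finset.sum_congr rfl fun k _ => ih (fun t => g₁ (A a k :: t)) k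

theorem pathSum_map_prod [Ring M] (l : List (Matrix ι ι M)) (F : M →+ R) (a b : ι) :
    pathSum l (fun t => F t.prod) a b = F (l.prod a b) := by
  induction l generalizing F a with
  | nil => simp [pathSum, Matrix.one_apply, apply_ite F]
  | cons A l ih =>
    simp only [pathSum, List.prod_cons, Matrix.mul_apply, map_sum]
    exact Finset.sum_congr rfl fun k _ => ih (F.comp (AddMonoidHom.mulLeft (A a k))) k

theorem pathSum_ofFn {n : ℕ} (X : Fin n → Matrix ι ι M) (g : List M → R) (a b : ι) :
    pathSum (List.ofFn X) g a b =
      ∑ p : Fin (n + 1) → ι, if p 0 = a ∧ p (Fin.last n) = b then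
        g (List.ofFn fun r : Fin n => X r (p r.castSucc) (p r.succ)) else 0 := by
  induction n generalizing g a with
  | zero =>
    rw [← (Equiv.funUnique (Fin 1) ι).symm.sum_comp]
    simp [pathSum, ite_and]
  | succ n ih =>
    rw [← (Fin.consEquiv fun _ : Fin (n + 2) => ι).sum_comp, Fintype.sum_prod_type]
    simp only [List.ofFn_succ, pathSum, ih, Fin.consEquiv_apply, Fin.cons_zero,
      ← Fin.succ_last, Fin.cons_succ, Fin.castSucc_zero, ← Fin.succ_castSucc, ite_and]
    rw [Finset.sum_comm, Finset.sum_comm (s := Finset.univ (α := ι))]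
    simp

end PathSum

/-- Cut a list into consecutive blocks of the given sizes, apply `F m` to the product of the
`m`-th block, and multiply the results in order. -/
def blockProd {M R : Type*} [Ring M] [Ring R] : List ℕ → (ℕ → M → R) → List M → R
  | [], _, _ => 1
  | k :: ks, F, l => F 0 (l.take k).prod * blockProd ks (fun m => F (m + 1)) (l.drop k)

theorem blockProd_eq_prod_mapIdx {M R : Type*} [Ring M] [Ring R] (ks : List ℕ)
    (F : ℕ → M → R) (l : List M) :
    blockProd ks F l =
      ((l.splitWrtCompositionAux ks).mapIdx fun m t => F m t.prod).prod := by
  induction ks generalizing F l with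
  | nil => simp [blockProd, List.splitWrtCompositionAux]
  | cons k ks ih =>
    simp [blockProd, List.splitWrtCompositionAux_cons, List.mapIdx_cons, ih]

theorem prod_ofFn_composition {M R : Type*} [Ring M] [Ring R] {n : ℕ} (c : Composition n)
    (F : ℕ → M → R) (x : Fin n → M) :
    (List.ofFn fun i : Fin c.length =>
      F i (List.ofFn fun j : Fin (c.blocksFun i) => x (c.embedding i j)).prod).prod =
      blockProd c.blocks F (List.ofFn x) := by
  rw [blockProd_eq_prod_mapIdx]
  change _ = (((List.ofFn x).splitWrtComposition c).mapIdx fun m t => F m t.prod).prod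
  congr 1
  refine List.ext_getElem (by simp [List.length_splitWrtComposition]) fun i h₁ h₂ => ?_
  have hi : i < c.length := by simpa using h₁
  simp only [List.getElem_ofFn, List.getElem_mapIdx, List.getElem_splitWrtComposition]
  congr 2
  refine List.ext_getElem ?_ fun j h₃ h₄ => ?_
  · have := c.sizeUpTo_le (i + 1)
    have h := c.sizeUpTo_succ hi
    simp only [List.length_ofFn, List.length_drop, List.length_take, Composition.blocksFun,
      List.get_eq_getElem]
    omega
  · simp only [List.getElem_ofFn, List.getElem_drop, List.getElem_take]
    rfl

theorem blockProd_matrix_map {ι M R : Type*} [Fintype ι] [DecidableEq ι] [Ring M] [Ring R]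
    (ks : List ℕ) (F : ℕ → M →+ R) (l : List (Matrix ι ι M)) (hl : l.length = ks.sum)
    (a b : ι) :
    blockProd ks (fun m (Y : Matrix ι ι M) => Y.map (F m)) l a b =
      pathSum l (fun t => blockProd ks (fun m => F m) t) a b := by
  induction ks generalizing F l a with
  | nil =>
    obtain rfl : l = [] := by simpa using hl
    simp [blockProd, pathSum, Matrix.one_apply]
  | cons k ks ih =>
    rw [List.sum_cons] at hl
    have hk : (l.take k).length = k := by simp; omega
    have key := pathSum_append (l.take k) (l.drop k) (fun t => F 0 t.prod)
      (fun t => blockProd ks (fun m => F (m + 1)) t) a b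
    rw [List.take_append_drop, hk] at key
    simp only [blockProd, key, Matrix.mul_apply, Matrix.map_apply, pathSum_map_prod]
    exact Finset.sum_congr rfl fun q _ => by
      rw [ih (fun m => F (m + 1)) (l.drop k) (by simp; omega)]

theorem dmomComp_matrix_entrywise {ι M R : Type*} [Fintype ι] [DecidableEq ι] [Ring M]
    [Ring R] (φ φ' : M →+ R) {n : ℕ} (c : Composition n) (X : Fin n → Matrix ι ι M)
    (a b : ι) :
    dmomComp (fun Y : Matrix ι ι M => Y.map φ) (fun Y : Matrix ι ι M => Y.map φ') c X a b =
      ∑ p : Fin (n + 1) → ι, if p 0 = a ∧ p (Fin.last n) = b then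
        dmomComp φ φ' c (fun r : Fin n => X r (p r.castSucc) (p r.succ)) else 0 := by
  have hscalar (s : Fin c.length) (x : Fin n → M) :
      (List.ofFn fun i : Fin c.length => (if i = s then ⇑φ' else ⇑φ)
        (List.ofFn fun j : Fin (c.blocksFun i) => x (c.embedding i j)).prod).prod =
      blockProd c.blocks (fun m => ⇑(if m = (s : ℕ) then φ' else φ)) (List.ofFn x) := by
    rw [← prod_ofFn_composition]
    congr 2
    funext i
    by_cases h : i = s <;> simp [h, Fin.val_inj]
  have hmatrix (s : Fin c.length) :
      (List.ofFn fun i : Fin c.length =>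
        (if i = s then fun Y : Matrix ι ι M => Y.map φ' else fun Y => Y.map φ)
        (List.ofFn fun j : Fin (c.blocksFun i) => X (c.embedding i j)).prod).prod =
      blockProd c.blocks
        (fun m (Y : Matrix ι ι M) => Y.map ⇑(if m = (s : ℕ) then φ' else φ))
        (List.ofFn X) := by
    rw [← prod_ofFn_composition]
    congr 2
    funext i
    by_cases h : i = s <;> simp [h, Fin.val_inj]
  simp only [dmomComp, Matrix.sum_apply, hmatrix]
  simp only [← Finset.sum_filter]
  rw [Finset.sum_comm]
  refine Finset.sum_congr rfl fun s _ => ?_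
  rw [blockProd_matrix_map c.blocks (fun m => if m = (s : ℕ) then φ' else φ) _ (by simp),
    pathSum_ofFn, Finset.sum_filter]
  exact Finset.sum_congr rfl fun p _ => by
    rw [hscalar s fun r => X r (p r.castSucc) (p r.succ)]

/-- Theorem: for an infinitesimal probability space `(M, φ, φ')` and the entrywise maps
`E = φ ⊗ Id_N`, `E' = φ' ⊗ Id_N` on `M_N(M)`, the operator-valued infinitesimal Boolean
cumulants of matrices are computed entrywise from the scalar infinitesimal Boolean
cumulants: `[∂β_n(X^{(1)},…,X^{(n)})]_{i,j} = Σ_{i₂,…,iₙ} β'_n(x^{(1)}_{i,i₂},…,x^{(n)}_{iₙ,j})`. -/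
theorem dBooCum_matrix_entrywise
    {M : Type*} [Ring M] [Algebra ℂ M]
    (φ φ' : M →ₗ[ℂ] ℂ) (hφ1 : φ 1 = 1) (hφ'1 : φ' 1 = 0)
    (N : ℕ) (hN : 1 ≤ N)
    (n : ℕ) (hn : 1 ≤ n) (X : Fin n → Matrix (Fin N) (Fin N) M)
    (i j : Fin N) :
    dBooCum (fun Y : Matrix (Fin N) (Fin N) M => Y.map ⇑φ)
        (fun Y : Matrix (Fin N) (Fin N) M => Y.map ⇑φ') n X i j =
      ∑ p : Fin (n + 1) → Fin N,
        if p 0 = i ∧ p (Fin.last n) = j then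
          dBooCum ⇑φ ⇑φ' n (fun r : Fin n => X r (p r.castSucc) (p r.succ))
        else 0 := by
  simp only [dBooCum, Matrix.sum_apply, Matrix.smul_apply, ← Finset.sum_filter]
  rw [Finset.sum_comm]
  refine Finset.sum_congr rfl fun c _ => ?_
  rw [← Finset.smul_sum, Finset.sum_filter]
  exact congrArg _ (dmomComp_matrix_entrywise φ.toAddMonoidHom φ'.toAddMonoidHom c X i j)
end
end

section
/- Let (A,φ,φ') be an infinitesimal probability space and let (a_i)_{i≥1} be an infinitesimally free sequence in A with identical distribution (for every k ≥ 1, φ(a_i^k) and φ'(a_i^k) do not depend on i) satisfying φ(a_1) = φ'(a_1) = 0, φ(a_1²) = 1 and φ'(a_1²) = α. Let S_N = (a_1 + ⋯ + a_N)/√N. Then for every k ≥ 1: lim_{N→∞} φ(S_N^k) = Catalan(k/2) if k is even and 0 if k is odd, and lim_{N→∞} φ'(S_N^k) = α·(k/2)·Catalan(k/2) if k is even and 0 if k is odd, where Catalan(l) denotes the l-th Catalan number. -/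
noncomputable section

open scoped BigOperators
open Filter Topology

variable {A : Type*} [Ring A] [Algebra ℂ A]

/-- The unital subalgebras `S i` are infinitesimally free with respect to `(φ, φ')`:
for adjacent-distinct indices and centered `x_j ∈ S i_j` (`φ(x_j) = 0`),
`φ(x_1⋯x_n) = 0` and `φ'(x_1⋯x_n) = Σ_j φ'(x_j)·φ(x_1⋯x_{j−1}x_{j+1}⋯x_n)`. -/
def InfFreeSeq (φ φ' : A → ℂ) (S : ℕ → Subalgebra ℂ A) : Prop :=
  ∀ n : ℕ, 0 < n → ∀ idx : Fin n → ℕ,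
    (∀ (k : Fin n) (h : k.val + 1 < n), idx k ≠ idx ⟨k.val + 1, h⟩) →
    ∀ x : Fin n → A, (∀ k, x k ∈ S (idx k)) → (∀ k, φ (x k) = 0) →
      φ (List.ofFn x).prod = 0 ∧
      φ' (List.ofFn x).prod =
        ∑ j : Fin n, φ' (x j) * φ ((List.ofFn x).eraseIdx j.val).prod

open Polynomial

/-- `∑ φ' x * φ (p * l₁ * l₂ * s)` over all splittings `l = l₁ ++ x :: l₂`. -/
def leibnizSum (φ φ' : A →ₗ[ℂ] ℂ) (s : A) : A → List A → ℂ
  | _, [] => 0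
  | p, x :: l => φ' x * φ (p * l.prod * s) + leibnizSum φ φ' s (p * x) l

/-- The values at a family `b` of a list of univariate polynomials labelled by indices of `b`. -/
def evalList {I : Type*} (b : I → A) (L : List (I × ℂ[X])) : List A :=
  L.map fun p => aeval (b p.1) p.2

/-- Adjacent labels differ and every polynomial is centered with respect to `μ`. -/
def IsCenteredAlternating {I : Type*} (μ : ℂ[X] →ₗ[ℂ] ℂ) (L : List (I × ℂ[X])) : Prop :=
  L.IsChain (fun p q => p.1 ≠ q.1) ∧ ∀ p ∈ L, μ p.2 = 0

/-- The family `b` is infinitesimally free with respect to `(φ, φ')`, and each member has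
distribution `μ` and infinitesimal distribution `μ'`. -/
structure IsInfFreeFamily {I : Type*} (φ φ' : A →ₗ[ℂ] ℂ) (μ μ' : ℂ[X] →ₗ[ℂ] ℂ) (b : I → A) :
    Prop where
  map_one : φ 1 = 1
  map_one' : φ' 1 = 0
  distrib_one : μ 1 = 1
  map_aeval : ∀ i f, φ (aeval (b i) f) = μ f
  map_aeval' : ∀ i f, φ' (aeval (b i) f) = μ' f
  map_prod : ∀ L, IsCenteredAlternating μ L → L ≠ [] → φ (evalList b L).prod = 0
  map_prod' : ∀ L, IsCenteredAlternating μ L →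
    φ' (evalList b L).prod = leibnizSum φ φ' 1 1 (evalList b L)

section leibnizSum

variable (φ φ' : A →ₗ[ℂ] ℂ)

lemma leibnizSum_append (s : A) (l₁ l₂ : List A) (p : A) :
    leibnizSum φ φ' s p (l₁ ++ l₂) =
      leibnizSum φ φ' (l₂.prod * s) p l₁ + leibnizSum φ φ' s (p * l₁.prod) l₂ := by
  induction l₁ generalizing p with
  | nil => simp [leibnizSum]
  | cons x l ih => simp [leibnizSum, ih, mul_assoc, add_assoc]

lemma leibnizSum_eq_mul (S : Subalgebra ℂ A) {p s : A} {c : ℂ}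
    (h : ∀ y ∈ S, φ (p * y * s) = c * φ y) (l : List A) (hl : ∀ x ∈ l, x ∈ S) :
    leibnizSum φ φ' s p l = c * leibnizSum φ φ' 1 1 l := by
  suffices H : ∀ q ∈ S, leibnizSum φ φ' s (p * q) l = c * leibnizSum φ φ' 1 q l by
    simpa using H 1 S.one_mem
  induction l with
  | nil => simp [leibnizSum]
  | cons x l ih =>
    intro q hq
    have hl' : l.prod ∈ S := S.list_prod_mem fun y hy => hl y (by simp [hy])
    have h₁ := h (q * l.prod) (S.mul_mem hq hl')
    have h₂ := ih (fun y hy => hl y (by simp [hy])) (q * x) (S.mul_mem hq (hl x (by simp)))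
    simp only [leibnizSum, mul_one]
    rw [mul_assoc p q x, h₂, mul_assoc p q, h₁]
    ring

lemma sum_eraseIdx_eq_leibnizSum (n : ℕ) (x : Fin n → A) (p : A) :
    ∑ j : Fin n, φ' (x j) * φ (p * ((List.ofFn x).eraseIdx j.val).prod) =
      leibnizSum φ φ' 1 p (List.ofFn x) := by
  induction n generalizing p with
  | zero => simp [leibnizSum]
  | succ n ih =>
    rw [Fin.sum_univ_succ, List.ofFn_succ, leibnizSum, ← ih]
    simp [mul_assoc]

lemma leibnizSum_congr {φ ψ φ' ψ' : A →ₗ[ℂ] ℂ} (h : φ = ψ) (s : A) (l : List A)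
    (hl : ∀ x ∈ l, φ' x = ψ' x) (p : A) :
    leibnizSum φ φ' s p l = leibnizSum ψ ψ' s p l := by
  subst h
  induction l generalizing p with
  | nil => rfl
  | cons x l ih =>
    rw [leibnizSum, leibnizSum, hl x (by simp), ih fun y hy => hl y (by simp [hy])]

lemma leibnizSum_comp {B : Type*} [Ring B] [Algebra ℂ B] (g : B →ₐ[ℂ] A) (s : B) (l : List B)
    (p : B) :
    leibnizSum (φ ∘ₗ g.toLinearMap) (φ' ∘ₗ g.toLinearMap) s p l =
      leibnizSum φ φ' (g s) (g p) (l.map g) := by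
  induction l generalizing p with
  | nil => rfl
  | cons x l ih => simp [leibnizSum, ih, map_list_prod]

end leibnizSum

section family

variable {I : Type*} (b : I → A)

@[simp] lemma evalList_nil : evalList b [] = [] := rfl

@[simp] lemma evalList_cons (p : I × ℂ[X]) (L : List (I × ℂ[X])) :
    evalList b (p :: L) = aeval (b p.1) p.2 :: evalList b L := rfl

@[simp] lemma evalList_append (L₁ L₂ : List (I × ℂ[X])) :
    evalList b (L₁ ++ L₂) = evalList b L₁ ++ evalList b L₂ := List.map_append ..

lemma aeval_mem_adjoin_image {J : Set I} {i : I} (hi : i ∈ J) (f : ℂ[X]) :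
    aeval (b i) f ∈ Algebra.adjoin ℂ (b '' J) :=
  Algebra.adjoin_mono (by simpa using ⟨i, hi, rfl⟩) (aeval_mem_adjoin_singleton ℂ (b i))

lemma mem_adjoin_of_mem_evalList {J : Set I} {L : List (I × ℂ[X])} (hL : ∀ p ∈ L, p.1 ∈ J) :
    ∀ x ∈ evalList b L, x ∈ Algebra.adjoin ℂ (b '' J) := by
  intro x hx
  obtain ⟨p, hp, rfl⟩ := List.mem_map.1 hx
  exact aeval_mem_adjoin_image b (hL p hp) _

/-- The products of centered alternating lists with labels in `J`. -/
def centeredProducts (μ : ℂ[X] →ₗ[ℂ] ℂ) (J : Set I) : Set A :=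
  {x | ∃ L, IsCenteredAlternating μ L ∧ (∀ p ∈ L, p.1 ∈ J) ∧ (evalList b L).prod = x}

variable {μ : ℂ[X] →ₗ[ℂ] ℂ}

lemma IsCenteredAlternating.nil : IsCenteredAlternating μ ([] : List (I × ℂ[X])) := by
  simp [IsCenteredAlternating]

lemma mul_mem_span_centeredProducts (hμ : μ 1 = 1) {J : Set I} {i : I} (hi : i ∈ J) {x : A}
    (hx : x ∈ Submodule.span ℂ (centeredProducts b μ J)) :
    b i * x ∈ Submodule.span ℂ (centeredProducts b μ J) := by
  have key (f : ℂ[X]) (L : List (I × ℂ[X])) (hL : IsCenteredAlternating μ L)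
      (hJ : ∀ p ∈ L, p.1 ∈ J) (hd : ∀ y ∈ L.head?, i ≠ y.1) :
      aeval (b i) f * (evalList b L).prod ∈ Submodule.span ℂ (centeredProducts b μ J) := by
    have h : aeval (b i) f * (evalList b L).prod =
        (evalList b ((i, f - C (μ f)) :: L)).prod + μ f • (evalList b L).prod := by
      simp [sub_mul, Algebra.smul_def]
    rw [h]
    refine add_mem (Submodule.subset_span ⟨_, ⟨List.isChain_cons.2 ⟨hd, hL.1⟩, ?_⟩, ?_, rfl⟩)
      (Submodule.smul_mem _ _ (Submodule.subset_span ⟨L, hL, hJ, rfl⟩))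
    · rintro p (_ | ⟨_, hp⟩)
      · rw [← mul_one (C (μ f)), ← smul_eq_C_mul]
        simp [hμ]
      · exact hL.2 p hp
    · rintro p (_ | ⟨_, hp⟩)
      exacts [hi, hJ p hp]
  induction hx using Submodule.span_induction with
  | zero => simp
  | add x y _ _ hx hy => rw [mul_add]; exact add_mem hx hy
  | smul c x _ hx => rw [mul_smul_comm]; exact Submodule.smul_mem _ _ hx
  | mem x hx =>
    obtain ⟨L, hL, hJ, rfl⟩ := hx
    by_cases hd : ∀ y ∈ L.head?, i ≠ y.1
    · simpa using key X L hL hJ hd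
    · match L, hL, hJ, hd with
      | [], _, _, hd => simp at hd
      | (j, f) :: L, hL, hJ, hd =>
        obtain rfl : i = j := by simpa using hd
        have := key (X * f) L ⟨(List.isChain_cons.1 hL.1).2, fun p hp => hL.2 p (by simp [hp])⟩
          (fun p hp => hJ p (by simp [hp])) (List.isChain_cons.1 hL.1).1
        simpa [mul_assoc] using this

lemma adjoin_image_le_span_centeredProducts (hμ : μ 1 = 1) (J : Set I) :
    Subalgebra.toSubmodule (Algebra.adjoin ℂ (b '' J)) ≤
      Submodule.span ℂ (centeredProducts b μ J) := by
  rw [Algebra.adjoin_eq_span, Submodule.span_le]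
  intro x hx
  induction hx using Submonoid.closure_induction_left with
  | one => exact Submodule.subset_span ⟨[], .nil, by simp, by simp⟩
  | mul_left x hx y _ ih =>
    obtain ⟨i, hi, rfl⟩ := hx
    exact mul_mem_span_centeredProducts b hμ hi ih

variable {b}

/-- Two bilinear identities on the algebra generated by `b '' J` agree once they agree on
products of centered alternating lists. -/
lemma eq_of_eq_on_centeredProducts (hμ : μ 1 = 1) {J : Set I} {F G : A →ₗ[ℂ] A →ₗ[ℂ] ℂ}
    (h : ∀ L₁ L₂ : List (I × ℂ[X]), IsCenteredAlternating μ L₁ → IsCenteredAlternating μ L₂ →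
      (∀ p ∈ L₁, p.1 ∈ J) → (∀ p ∈ L₂, p.1 ∈ J) →
      F (evalList b L₁).prod (evalList b L₂).prod = G (evalList b L₁).prod (evalList b L₂).prod)
    {u v : A} (hu : u ∈ Algebra.adjoin ℂ (b '' J)) (hv : v ∈ Algebra.adjoin ℂ (b '' J)) :
    F u v = G u v := by
  have hu' := adjoin_image_le_span_centeredProducts b hμ J hu
  have hv' := adjoin_image_le_span_centeredProducts b hμ J hv
  have h₂ : Set.EqOn (F.flip v) (G.flip v) (centeredProducts b μ J) := by
    rintro _ ⟨L₁, h₁, hJ₁, rfl⟩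
    refine LinearMap.eqOn_span (s := centeredProducts b μ J) (f := F _) (g := G _) ?_ hv'
    rintro _ ⟨L₂, h₂, hJ₂, rfl⟩
    exact h L₁ L₂ h₁ h₂ hJ₁ hJ₂
  exact LinearMap.eqOn_span h₂ hu'

end family

namespace IsInfFreeFamily

variable {I : Type*} {φ φ' : A →ₗ[ℂ] ℂ} {μ μ' : ℂ[X] →ₗ[ℂ] ℂ} {b : I → A}

lemma cons_isCenteredAlternating {J : Set I} {i : I} (hi : i ∉ J) {f : ℂ[X]} (hf : μ f = 0)
    {L : List (I × ℂ[X])} (hL : IsCenteredAlternating μ L) (hJ : ∀ p ∈ L, p.1 ∈ J) :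
    IsCenteredAlternating μ ((i, f) :: L) := by
  refine ⟨List.isChain_cons.2 ⟨?_, hL.1⟩, ?_⟩
  · rintro y hy rfl
    exact hi (hJ y (List.mem_of_mem_head? hy))
  · rintro p (_ | ⟨_, hp⟩)
    exacts [hf, hL.2 p hp]

lemma append_isCenteredAlternating {J : Set I} {i : I} (hi : i ∉ J) {f : ℂ[X]}
    {L₁ L₂ : List (I × ℂ[X])} (h₁ : IsCenteredAlternating μ L₁) (hJ : ∀ p ∈ L₁, p.1 ∈ J)
    (h₂ : IsCenteredAlternating μ ((i, f) :: L₂)) :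
    IsCenteredAlternating μ (L₁ ++ (i, f) :: L₂) := by
  refine ⟨List.isChain_append.2 ⟨h₁.1, h₂.1, ?_⟩, ?_⟩
  · rintro x hx y hy
    obtain rfl : (i, f) = y := by simpa using hy
    rintro rfl
    exact hi (hJ x (List.mem_of_getLast? hx))
  · intro p hp
    rcases List.mem_append.1 hp with hp | hp
    exacts [h₁.2 p hp, h₂.2 p hp]

lemma pair_isCenteredAlternating {J : Set I} {i : I} (hi : i ∉ J) {f : ℂ[X]} (hf : μ f = 0)
    {L₁ L₂ : List (I × ℂ[X])} (h₁ : IsCenteredAlternating μ L₁) (hne : L₁ ≠ [])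
    (hJ₁ : ∀ p ∈ L₁, p.1 ∈ J) (h₂ : IsCenteredAlternating μ L₂) (hJ₂ : ∀ p ∈ L₂, p.1 ∈ J) :
    IsCenteredAlternating μ ((i, f) :: (L₁ ++ (i, f) :: L₂)) := by
  have h := append_isCenteredAlternating hi h₁ hJ₁ (cons_isCenteredAlternating hi hf h₂ hJ₂)
  refine ⟨List.isChain_cons.2 ⟨?_, h.1⟩, ?_⟩
  · rintro y hy rfl
    rw [List.head?_append_of_ne_nil _ hne] at hy
    exact hi (hJ₁ y (List.mem_of_mem_head? hy))
  · rintro p (_ | ⟨_, hp⟩)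
    exacts [hf, h.2 p hp]

lemma map_mul_centered_mul (h : IsInfFreeFamily φ φ' μ μ' b) {J : Set I} {i : I} (hi : i ∉ J)
    {f : ℂ[X]} (hf : μ f = 0) {u v : A} (hu : u ∈ Algebra.adjoin ℂ (b '' J))
    (hv : v ∈ Algebra.adjoin ℂ (b '' J)) : φ (u * aeval (b i) f * v) = 0 := by
  refine eq_of_eq_on_centeredProducts (b := b) (J := J) h.distrib_one
    (F := ((LinearMap.mul ℂ A).compr₂ φ) ∘ₗ LinearMap.mulRight ℂ (aeval (b i) f)) (G := 0)
    (fun L₁ L₂ h₁ h₂ hJ₁ hJ₂ => ?_) hu hv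
  have := h.map_prod _ (append_isCenteredAlternating hi h₁ hJ₁
    (cons_isCenteredAlternating hi hf h₂ hJ₂)) (by simp)
  simpa [mul_assoc] using this

lemma map_centered_mul (h : IsInfFreeFamily φ φ' μ μ' b) {J : Set I} {i : I} (hi : i ∉ J)
    {f : ℂ[X]} (hf : μ f = 0) {v : A} (hv : v ∈ Algebra.adjoin ℂ (b '' J)) :
    φ (aeval (b i) f * v) = 0 := by
  simpa using h.map_mul_centered_mul hi hf (one_mem _) hv

lemma distrib_sub_C (h : IsInfFreeFamily φ φ' μ μ' b) (f : ℂ[X]) : μ (f - C (μ f)) = 0 := by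
  rw [← mul_one (C (μ f)), ← smul_eq_C_mul]
  simp [h.distrib_one]

lemma map_aeval_mul (h : IsInfFreeFamily φ φ' μ μ' b) {J : Set I} {i : I} (hi : i ∉ J)
    (f : ℂ[X]) {v : A} (hv : v ∈ Algebra.adjoin ℂ (b '' J)) :
    φ (aeval (b i) f * v) = μ f * φ v := by
  have := h.map_centered_mul hi (h.distrib_sub_C f) hv
  simpa [sub_mul, sub_eq_zero, ← Algebra.smul_def] using this

lemma map_pair (h : IsInfFreeFamily φ φ' μ μ' b) (hX : μ X = 0) {J : Set I} {i : I} (hi : i ∉ J)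
    {u v : A} (hu : u ∈ Algebra.adjoin ℂ (b '' J)) (hv : v ∈ Algebra.adjoin ℂ (b '' J)) :
    φ (b i * u * b i * v) = μ (X ^ 2) * (φ u * φ v) := by
  refine eq_of_eq_on_centeredProducts (b := b) (J := J) h.distrib_one
    (F := ((LinearMap.mul ℂ A).compr₂ φ) ∘ₗ LinearMap.mulRight ℂ (b i) ∘ₗ
      LinearMap.mulLeft ℂ (b i))
    (G := μ (X ^ 2) • (LinearMap.mul ℂ ℂ).compl₁₂ φ φ)
    (fun L₁ L₂ h₁ h₂ hJ₁ hJ₂ => ?_) hu hv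
  have hv : (evalList b L₂).prod ∈ Algebra.adjoin ℂ (b '' J) :=
    Subalgebra.list_prod_mem _ (mem_adjoin_of_mem_evalList b hJ₂)
  rcases eq_or_ne L₁ [] with rfl | hne
  · have hsq : aeval (b i) (X ^ 2 : ℂ[X]) = b i * b i := by rw [map_pow, aeval_X, sq]
    have key := h.map_aeval_mul hi (X ^ 2) hv
    rw [hsq] at key
    simpa [h.map_one] using key
  · have := h.map_prod _ (pair_isCenteredAlternating hi hX h₁ hne hJ₁ h₂ hJ₂) (by simp)
    simp only [evalList_cons, evalList_append, List.prod_cons, List.prod_append, aeval_X] at this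
    simp [mul_assoc, this, h.map_prod _ h₁ hne]

lemma map_mul_mul' (h : IsInfFreeFamily φ φ' μ μ' b) (hX : μ X = 0) (hX' : μ' X = 0) {J : Set I}
    {i : I} (hi : i ∉ J) {u v : A} (hu : u ∈ Algebra.adjoin ℂ (b '' J))
    (hv : v ∈ Algebra.adjoin ℂ (b '' J)) : φ' (u * b i * v) = 0 := by
  refine eq_of_eq_on_centeredProducts (b := b) (J := J) h.distrib_one
    (F := ((LinearMap.mul ℂ A).compr₂ φ') ∘ₗ LinearMap.mulRight ℂ (b i)) (G := 0)
    (fun L₁ L₂ h₁ h₂ hJ₁ hJ₂ => ?_) hu hv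
  have hm₁ := mem_adjoin_of_mem_evalList b hJ₁
  have hm₂ := mem_adjoin_of_mem_evalList b hJ₂
  have hp₁ := Subalgebra.list_prod_mem _ hm₁
  have hp₂ := Subalgebra.list_prod_mem _ hm₂
  have key := h.map_prod' _ (append_isCenteredAlternating hi h₁ hJ₁
    (cons_isCenteredAlternating hi hX h₂ hJ₂))
  have hb : φ' (b i) = 0 := by simpa [hX'] using h.map_aeval' i X
  rw [evalList_append, leibnizSum_append, evalList_cons, leibnizSum,
    leibnizSum_eq_mul φ φ' (Algebra.adjoin ℂ (b '' J)) (c := 0) ?_ _ hm₁,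
    leibnizSum_eq_mul φ φ' (Algebra.adjoin ℂ (b '' J)) (c := 0) ?_ _ hm₂] at key
  · simpa [mul_assoc, hb] using key
  · intro y hy
    simpa using h.map_mul_centered_mul hi hX hp₁ hy
  · intro y hy
    simpa [mul_assoc] using h.map_mul_centered_mul hi hX hy hp₂

lemma map_aeval_mul' (h : IsInfFreeFamily φ φ' μ μ' b) {J : Set I} {i : I} (hi : i ∉ J)
    (f : ℂ[X]) {L : List (I × ℂ[X])} (hL : IsCenteredAlternating μ L) (hJ : ∀ p ∈ L, p.1 ∈ J) :
    φ' (aeval (b i) f * (evalList b L).prod) =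
      μ' f * φ (evalList b L).prod + μ f * φ' (evalList b L).prod := by
  have hm := mem_adjoin_of_mem_evalList b hJ
  have key := h.map_prod' _ (cons_isCenteredAlternating hi (h.distrib_sub_C f) hL hJ)
  rw [evalList_cons, leibnizSum,
    leibnizSum_eq_mul φ φ' (Algebra.adjoin ℂ (b '' J)) (c := 0) ?_ _ hm] at key
  · have hc : φ' (algebraMap ℂ A (μ f)) = 0 := by
      rw [Algebra.algebraMap_eq_smul_one, map_smul, h.map_one', smul_zero]
    simpa [sub_mul, hc, h.map_aeval', sub_eq_iff_eq_add, ← Algebra.smul_def] using key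
  · intro y hy
    simpa using h.map_centered_mul hi (h.distrib_sub_C f) hy

lemma map_pair' (h : IsInfFreeFamily φ φ' μ μ' b) (hX : μ X = 0) (hX' : μ' X = 0) {J : Set I}
    {i : I} (hi : i ∉ J) {u v : A} (hu : u ∈ Algebra.adjoin ℂ (b '' J))
    (hv : v ∈ Algebra.adjoin ℂ (b '' J)) :
    φ' (b i * u * b i * v) =
      μ' (X ^ 2) * (φ u * φ v) + μ (X ^ 2) * (φ' u * φ v + φ u * φ' v) := by
  refine eq_of_eq_on_centeredProducts (b := b) (J := J) h.distrib_one
    (F := ((LinearMap.mul ℂ A).compr₂ φ') ∘ₗ LinearMap.mulRight ℂ (b i) ∘ₗ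
      LinearMap.mulLeft ℂ (b i))
    (G := μ' (X ^ 2) • (LinearMap.mul ℂ ℂ).compl₁₂ φ φ + μ (X ^ 2) •
      ((LinearMap.mul ℂ ℂ).compl₁₂ φ' φ + (LinearMap.mul ℂ ℂ).compl₁₂ φ φ'))
    (fun L₁ L₂ h₁ h₂ hJ₁ hJ₂ => ?_) hu hv
  have hm₁ := mem_adjoin_of_mem_evalList b hJ₁
  have hm₂ := mem_adjoin_of_mem_evalList b hJ₂
  have hp₁ := Subalgebra.list_prod_mem _ hm₁
  have hp₂ := Subalgebra.list_prod_mem _ hm₂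
  rcases eq_or_ne L₁ [] with rfl | hne
  · have hsq : aeval (b i) (X ^ 2 : ℂ[X]) = b i * b i := by rw [map_pow, aeval_X, sq]
    have key := h.map_aeval_mul' hi (X ^ 2) h₂ hJ₂
    rw [hsq] at key
    simpa [h.map_one, h.map_one'] using key
  · have hz := h.map_prod _ h₁ hne
    have key := h.map_prod' _ (pair_isCenteredAlternating hi hX h₁ hne hJ₁ h₂ hJ₂)
    have hb : φ' (b i) = 0 := by simpa [hX'] using h.map_aeval' i X
    rw [evalList_cons, leibnizSum, evalList_append, leibnizSum_append, evalList_cons, leibnizSum,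
      leibnizSum_eq_mul φ φ' (Algebra.adjoin ℂ (b '' J))
        (c := μ (X ^ 2) * φ (evalList b L₂).prod) ?_ _ hm₁,
      leibnizSum_eq_mul φ φ' (Algebra.adjoin ℂ (b '' J)) (c := 0) ?_ _ hm₂,
      ← h.map_prod' _ h₁] at key
    · simp [mul_assoc, hb] at key
      simp [mul_assoc, key, hz, mul_comm]
    · intro y hy
      simpa [hz] using h.map_pair hX hi hp₁ hy
    · intro y hy
      simpa [mul_assoc, mul_comm, mul_left_comm] using h.map_pair hX hi hy hp₂

lemma eq_of_adjoin_range_eq_top (h : IsInfFreeFamily φ φ' μ μ' b) {ψ ψ' : A →ₗ[ℂ] ℂ}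
    (h₂ : IsInfFreeFamily ψ ψ' μ μ' b) (hb : Algebra.adjoin ℂ (Set.range b) = ⊤) :
    φ = ψ ∧ φ' = ψ' := by
  have hspan : Submodule.span ℂ (centeredProducts b μ Set.univ) = ⊤ := by
    have := adjoin_image_le_span_centeredProducts b h.distrib_one Set.univ
    rwa [Set.image_univ, hb, Algebra.top_toSubmodule, top_le_iff] at this
  have heq : φ = ψ := by
    refine LinearMap.ext_on hspan ?_
    rintro _ ⟨L, hL, -, rfl⟩
    rcases eq_or_ne L [] with rfl | hne
    · simp [h.map_one, h₂.map_one]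
    · rw [h.map_prod _ hL hne, h₂.map_prod _ hL hne]
  refine ⟨heq, LinearMap.ext_on hspan ?_⟩
  rintro _ ⟨L, hL, -, rfl⟩
  rw [h.map_prod' _ hL, h₂.map_prod' _ hL]
  refine leibnizSum_congr heq _ _ (fun x hx => ?_) _
  obtain ⟨p, -, rfl⟩ := List.mem_map.1 hx
  rw [h.map_aeval', h₂.map_aeval']

lemma comp_algHom {B : Type*} [Ring B] [Algebra ℂ B] (g : B →ₐ[ℂ] A) {b : I → B}
    (h : IsInfFreeFamily φ φ' μ μ' fun i => g (b i)) :
    IsInfFreeFamily (φ ∘ₗ g.toLinearMap) (φ' ∘ₗ g.toLinearMap) μ μ' b := by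
  have hmap (L : List (I × ℂ[X])) : (evalList b L).map g = evalList (fun i => g (b i)) L := by
    simp [evalList, Polynomial.aeval_algHom_apply]
  refine ⟨by simp [h.map_one], by simp [h.map_one'], h.distrib_one, ?_, ?_, ?_, ?_⟩
  · intro i f
    simpa [Polynomial.aeval_algHom_apply] using h.map_aeval i f
  · intro i f
    simpa [Polynomial.aeval_algHom_apply] using h.map_aeval' i f
  · intro L hL hne
    simpa [map_list_prod, hmap] using h.map_prod L hL hne
  · intro L hL
    rw [leibnizSum_comp, hmap]
    simpa [map_list_prod, hmap] using h.map_prod' L hL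

lemma comp_injective {K : Type*} {σ : K → I} (hσ : σ.Injective)
    (h : IsInfFreeFamily φ φ' μ μ' b) : IsInfFreeFamily φ φ' μ μ' (b ∘ σ) := by
  have hmap (L : List (K × ℂ[X])) :
      evalList b (L.map (Prod.map σ id)) = evalList (b ∘ σ) L := by
    simp [evalList]
  have hca {L : List (K × ℂ[X])} (hL : IsCenteredAlternating μ L) :
      IsCenteredAlternating μ (L.map (Prod.map σ id)) := by
    refine ⟨(List.isChain_map _).2 (hL.1.imp fun p q hpq => by simpa [hσ.eq_iff] using hpq), ?_⟩
    intro p hp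
    obtain ⟨q, hq, rfl⟩ := List.mem_map.1 hp
    exact hL.2 q hq
  refine ⟨h.map_one, h.map_one', h.distrib_one, fun i f => h.map_aeval _ f,
    fun i f => h.map_aeval' _ f, fun L hL hne => ?_, fun L hL => ?_⟩
  · rw [← hmap]
    exact h.map_prod _ (hca hL) (by simpa using hne)
  · rw [← hmap]
    exact h.map_prod' _ (hca hL)

lemma map_word_comp_injective (h : IsInfFreeFamily φ φ' μ μ' b) {σ : I → I} (hσ : σ.Injective)
    (w : List I) :
    φ ((w.map σ).map b).prod = φ (w.map b).prod ∧ φ' ((w.map σ).map b).prod = φ' (w.map b).prod := by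
  have hf (c : I → A) (hc : IsInfFreeFamily φ φ' μ μ' c) :=
    comp_algHom (FreeAlgebra.lift ℂ c) (b := FreeAlgebra.ι ℂ)
      (by simpa [FreeAlgebra.lift_ι_apply] using hc)
  have hw (c : I → A) : FreeAlgebra.lift ℂ c (w.map (FreeAlgebra.ι ℂ)).prod = (w.map c).prod := by
    simp [map_list_prod, Function.comp_def, FreeAlgebra.lift_ι_apply]
  obtain ⟨h₁, h₂⟩ := (hf _ (h.comp_injective hσ)).eq_of_adjoin_range_eq_top (hf _ h)
    (FreeAlgebra.adjoin_range_ι ℂ I)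
  have h₁ := LinearMap.congr_fun h₁ (w.map (FreeAlgebra.ι ℂ)).prod
  have h₂ := LinearMap.congr_fun h₂ (w.map (FreeAlgebra.ι ℂ)).prod
  simp only [LinearMap.comp_apply, AlgHom.toLinearMap_apply, hw] at h₁ h₂
  simpa using ⟨h₁, h₂⟩

end IsInfFreeFamily

lemma InfFreeSeq.isInfFreeFamily {φ φ' : A →ₗ[ℂ] ℂ} (hφ1 : φ 1 = 1) (hφ'1 : φ' 1 = 0)
    {a : ℕ → A} (hindep : InfFreeSeq ⇑φ ⇑φ' fun i => Algebra.adjoin ℂ {a i})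
    (hident : ∀ k : ℕ, 1 ≤ k → ∀ i j : ℕ,
      φ (a i ^ k) = φ (a j ^ k) ∧ φ' (a i ^ k) = φ' (a j ^ k)) :
    IsInfFreeFamily φ φ' (φ ∘ₗ (aeval (a 0)).toLinearMap) (φ' ∘ₗ (aeval (a 0)).toLinearMap) a := by
  have hpow (k i : ℕ) : φ (a i ^ k) = φ (a 0 ^ k) ∧ φ' (a i ^ k) = φ' (a 0 ^ k) := by
    rcases Nat.eq_zero_or_pos k with rfl | hk
    · simp
    · exact hident k hk i 0
  have haeval (i : ℕ) (f : ℂ[X]) :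
      φ (aeval (a i) f) = φ (aeval (a 0) f) ∧ φ' (aeval (a i) f) = φ' (aeval (a 0) f) := by
    simp [aeval_eq_sum_range, (hpow _ i).1, (hpow _ i).2]
  have key (L : List (ℕ × ℂ[X]))
      (hL : IsCenteredAlternating (φ ∘ₗ (aeval (a 0)).toLinearMap) L) (hne : L ≠ []) :
      φ (evalList a L).prod = 0 ∧
        φ' (evalList a L).prod = leibnizSum φ φ' 1 1 (evalList a L) := by
    have hofFn : List.ofFn (fun k => aeval (a (L.get k).1) (L.get k).2) = evalList a L := by
      conv_rhs => rw [evalList, ← List.ofFn_get L, List.map_ofFn]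
      rfl
    have h := hindep L.length (List.length_pos_iff.2 hne) (fun k => (L.get k).1)
      (fun k hk => List.isChain_iff_getElem.1 hL.1 k hk)
      (fun k => aeval (a (L.get k).1) (L.get k).2)
      (fun k => aeval_mem_adjoin_singleton ℂ _)
      (fun k => ((haeval _ _).1.trans (hL.2 _ (L.get_mem k))))
    have hsum := sum_eraseIdx_eq_leibnizSum φ φ' L.length
      (fun k => aeval (a (L.get k).1) (L.get k).2) 1
    simp only [one_mul] at hsum
    rwa [hsum, hofFn] at h
  refine ⟨hφ1, hφ'1, by simp [hφ1], fun i f => (haeval i f).1, fun i f => (haeval i f).2,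
    fun L hL hne => (key L hL hne).1, fun L hL => ?_⟩
  rcases eq_or_ne L [] with rfl | hne
  · simp [leibnizSum, hφ'1]
  · exact (key L hL hne).2

/-- The words of length `k` in the letters `0, …, N - 1`. -/
def words (N : ℕ) : ℕ → Finset (List ℕ)
  | 0 => {[]}
  | k + 1 => (Finset.range N ×ˢ words N k).image fun p => p.1 :: p.2

section words

lemma mem_words {N k : ℕ} {w : List ℕ} : w ∈ words N k ↔ w.length = k ∧ ∀ x ∈ w, x < N := by
  induction k generalizing w with
  | zero => simp +contextual [words]
  | succ k ih =>
    cases w with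
    | nil => simp [words]
    | cons x w => simp [words, ih, and_left_comm]

lemma sum_words_succ {M : Type*} [AddCommMonoid M] (N k : ℕ) (F : List ℕ → M) :
    ∑ w ∈ words N (k + 1), F w = ∑ i ∈ Finset.range N, ∑ w ∈ words N k, F (i :: w) := by
  rw [words, Finset.sum_image (by rintro ⟨_, _⟩ _ ⟨_, _⟩ _ h; simpa using h),
    Finset.sum_product]

lemma sum_words_add {M : Type*} [AddCommMonoid M] (N p q : ℕ) (F : List ℕ → M) :
    ∑ w ∈ words N (p + q), F w = ∑ u ∈ words N p, ∑ v ∈ words N q, F (u ++ v) := by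
  induction p generalizing F with
  | zero => simp [words]
  | succ p ih =>
    rw [Nat.add_right_comm, sum_words_succ, sum_words_succ]
    exact Finset.sum_congr rfl fun i _ => ih _

lemma card_words (N k : ℕ) : (words N k).card = N ^ k := by
  induction k with
  | zero => simp [words]
  | succ k ih =>
    rw [Finset.card_eq_sum_ones, sum_words_succ]
    simp [ih, pow_succ']

lemma sum_pow_eq_sum_words {B : Type*} [Semiring B] (a : ℕ → B) (N k : ℕ) :
    (∑ i ∈ Finset.range N, a i) ^ k = ∑ w ∈ words N k, (w.map a).prod := by
  induction k with
  | zero => simp [words]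
  | succ k ih =>
    rw [pow_succ', ih, sum_words_succ, Finset.sum_mul_sum]
    simp

lemma card_filter_words_le (N n d : ℕ) :
    ((words N n).filter fun w => w ≠ [] ∧ w.toFinset.card ≤ d).card ≤ N ^ d * d ^ n := by
  rw [← card_words N d, ← card_words d n, ← Finset.card_product]
  refine (Finset.card_le_card ?_).trans (Finset.card_image_le
    (f := fun p : List ℕ × List ℕ => p.2.map fun j => p.1.getD j 0))
  intro w hw
  simp only [Finset.mem_filter, mem_words] at hw
  obtain ⟨⟨hlen, hlt⟩, hne, hcard⟩ := hw
  rw [List.card_toFinset] at hcard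
  have hidx (x : ℕ) (hx : x ∈ w) : w.dedup.idxOf x < w.dedup.length :=
    List.idxOf_lt_length_iff.2 (List.mem_dedup.2 hx)
  simp only [Finset.mem_image, Finset.mem_product, mem_words]
  refine ⟨(w.dedup ++ List.replicate (d - w.dedup.length) (w.head hne),
    w.map w.dedup.idxOf), ⟨⟨?_, ?_⟩, by simpa using hlen, ?_⟩, ?_⟩
  · simp only [List.length_append, List.length_replicate]
    omega
  · intro x hx
    rcases List.mem_append.1 hx with hx | hx
    · exact hlt x (List.mem_dedup.1 hx)
    · rw [List.eq_of_mem_replicate hx]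
      exact hlt _ (List.head_mem hne)
  · intro x hx
    obtain ⟨y, hy, rfl⟩ := List.mem_map.1 hx
    exact (hidx y hy).trans_le hcard
  · rw [List.map_map]
    conv_rhs => rw [← List.map_id w]
    refine List.map_congr_left fun x hx => ?_
    have h := hidx x hx
    simp [List.getD_eq_getElem?_getD, List.getElem?_append_left h, h]

lemma two_mul_card_toFinset_lt {w : List ℕ} (h : ∀ x ∈ w, 2 ≤ w.count x) {i : ℕ}
    (hi : 3 ≤ w.count i) : 2 * w.toFinset.card < w.length := by
  rw [← List.sum_toFinset_count_eq_length, mul_comm, ← smul_eq_mul, ← Finset.sum_const]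
  have hmem : i ∈ w := List.count_pos_iff.1 (by omega)
  exact Finset.sum_lt_sum (fun x hx => h x (by simpa using hx)) ⟨i, by simpa using hmem, hi⟩

/-- Every word is an injective relabelling of a word of length `k` in the letters `< k`. -/
lemma exists_injective_map_eq (w : List ℕ) :
    ∃ σ : ℕ → ℕ, σ.Injective ∧ ∃ v ∈ words w.length w.length, v.map σ = w := by
  have hidx (x : ℕ) (hx : x ∈ w) : w.dedup.idxOf x < w.dedup.length :=
    List.idxOf_lt_length_iff.2 (List.mem_dedup.2 hx)
  have hle (x : ℕ) (hx : x ∈ w.dedup) : x ≤ w.dedup.sum := List.single_le_sum (by simp) x hx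
  refine ⟨fun j => if h : j < w.dedup.length then w.dedup[j] else w.dedup.sum + 1 + j, ?_,
    w.map w.dedup.idxOf, mem_words.2 ⟨by simp, ?_⟩, ?_⟩
  · intro j l hjl
    dsimp only at hjl
    split_ifs at hjl with hj hl hl
    · exact (List.Nodup.getElem_inj_iff w.nodup_dedup).1 hjl
    · have := hle _ (List.getElem_mem hj)
      omega
    · have := hle _ (List.getElem_mem hl)
      omega
    · omega
  · intro x hx
    obtain ⟨y, hy, rfl⟩ := List.mem_map.1 hx
    exact (hidx y hy).trans_le w.dedup_sublist.length_le
  · rw [List.map_map]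
    conv_rhs => rw [← List.map_id w]
    refine List.map_congr_left fun x hx => ?_
    simp [hidx x hx]

end words

open Finset.HasAntidiagonal (antidiagonal mem_antidiagonal)

/-- A weight on words that is invariant under relabelling, vanishes on words with a letter
occurring once, and factors out a letter occurring twice with one occurrence in front. -/
structure IsPairWeight {R : Type*} [CommRing R] (f : List ℕ → R) (c : R) : Prop where
  nil : f [] = 1
  map_injective : ∀ (σ : ℕ → ℕ), σ.Injective → ∀ w, f (w.map σ) = f w
  singleton : ∀ u v i, i ∉ u → i ∉ v → f (u ++ i :: v) = 0
  pair : ∀ u v i, i ∉ u → i ∉ v → f (i :: (u ++ i :: v)) = c * (f u * f v)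

namespace IsPairWeight

section algebra

variable {R : Type*} [CommRing R] {f : List ℕ → R} {c : R}

lemma eq_zero_of_count_eq_one (h : IsPairWeight f c) {x : ℕ} {w : List ℕ}
    (hx : w.count x = 1) : f w = 0 := by
  obtain ⟨s, t, rfl⟩ := List.append_of_mem (List.count_pos_iff.1 (by omega : 0 < w.count x))
  simp only [List.count_append, List.count_cons_self] at hx
  exact h.singleton _ _ _ (List.count_eq_zero.1 (by omega)) (List.count_eq_zero.1 (by omega))

/-- The contribution of the factorization of `i :: w` at position `p` of `w`. -/
def pairTerm (f : List ℕ → R) (c : R) (i : ℕ) (w : List ℕ) (p : ℕ) : R :=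
  if w[p]? = some i then c * (f (w.take p) * f (w.drop (p + 1))) else 0

/-- The failure of the two-point recursion on a word. -/
def defect (f : List ℕ → R) (c : R) (k : ℕ) : List ℕ → R
  | [] => 0
  | i :: w => f (i :: w) - ∑ pq ∈ antidiagonal k, pairTerm f c i w pq.1

lemma pairTerm_eq_zero_of_notMem (f : List ℕ → R) (c : R) {i : ℕ} {w : List ℕ} (hi : i ∉ w)
    (p : ℕ) : pairTerm f c i w p = 0 :=
  if_neg fun hp => hi (List.mem_of_getElem? hp)

lemma pairTerm_append (f : List ℕ → R) (c : R) (i : ℕ) (u v : List ℕ) :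
    pairTerm f c i (u ++ i :: v) u.length = c * (f u * f v) := by
  have hdrop : (u ++ i :: v).drop (u.length + 1) = v := by simp [← List.drop_drop]
  simp [pairTerm, hdrop]

lemma pairTerm_eq_zero_of_count_eq_one (h : IsPairWeight f c) {i x : ℕ} {w : List ℕ}
    (hxi : x ≠ i) (hx : w.count x = 1) (p : ℕ) : pairTerm f c i w p = 0 := by
  rw [pairTerm]
  split_ifs with hp
  · obtain ⟨hlt, hp⟩ := List.getElem?_eq_some_iff.1 hp
    have hw : w.take p ++ i :: w.drop (p + 1) = w := by
      rw [← hp, ← List.drop_eq_getElem_cons hlt, List.take_append_drop]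
    rw [← hw, List.count_append, List.count_cons_of_ne hxi.symm] at hx
    rcases Nat.eq_zero_or_pos ((w.take p).count x) with h0 | h0
    · rw [h.eq_zero_of_count_eq_one (w := w.drop (p + 1)) (x := x) (by omega)]
      simp
    · rw [h.eq_zero_of_count_eq_one (w := w.take p) (x := x) (by omega)]
      simp
  · rfl

lemma defect_ne_zero (h : IsPairWeight f c) {k : ℕ} {w : List ℕ} (hw : w.length = k + 2)
    (hd : defect f c k w ≠ 0) : w ≠ [] ∧ w.toFinset.card ≤ (k + 1) / 2 := by
  match w, hw, hd with
  | i :: w, hw, hd =>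
    have hlen : w.length = k + 1 := by simpa using hw
    have hother (x : ℕ) (hxi : x ≠ i) : w.count x ≠ 1 := fun hx => hd <| by
      rw [defect, h.eq_zero_of_count_eq_one (x := x) (by rwa [List.count_cons_of_ne hxi.symm]),
        Finset.sum_eq_zero fun pq _ => h.pairTerm_eq_zero_of_count_eq_one hxi hx _, sub_zero]
    have hzero : w.count i ≠ 0 := fun hi => hd <| by
      have hi' := List.count_eq_zero.1 hi
      rw [defect, h.eq_zero_of_count_eq_one (x := i) (by simp [hi]),
        Finset.sum_eq_zero fun pq _ => pairTerm_eq_zero_of_notMem f c hi' _, sub_zero]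
    have hone : w.count i ≠ 1 := fun hi => hd <| by
      obtain ⟨u, v, rfl⟩ := List.append_of_mem
        (List.count_pos_iff.1 (by omega : 0 < w.count i))
      simp only [List.count_append, List.count_cons_self] at hi
      have hu : i ∉ u := List.count_eq_zero.1 (by omega)
      have hv : i ∉ v := List.count_eq_zero.1 (by omega)
      have huv : u.length + v.length = k := by
        simp only [List.length_append, List.length_cons] at hlen
        omega
      rw [defect, h.pair u v i hu hv, Finset.sum_eq_single (u.length, v.length),
        pairTerm_append, sub_self]
      · rintro ⟨p, q⟩ hpq hne
        refine if_neg fun hp => ?_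
        rcases lt_trichotomy p u.length with hlt | heq | hgt
        · rw [List.getElem?_append_left hlt] at hp
          exact hu (List.mem_of_getElem? hp)
        · rw [mem_antidiagonal] at hpq
          refine hne (Prod.ext heq ?_)
          simp only at hpq heq ⊢
          omega
        · obtain ⟨r, hr⟩ : ∃ r, p - u.length = r + 1 := ⟨p - u.length - 1, by omega⟩
          rw [List.getElem?_append_right hgt.le, hr, List.getElem?_cons_succ] at hp
          exact hv (List.mem_of_getElem? hp)
      · simp [huv]
    refine ⟨by simp, ?_⟩
    have := two_mul_card_toFinset_lt (w := i :: w) (i := i) (fun x hx => ?_)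
      (by rw [List.count_cons_self]; omega)
    · rw [hw] at this
      omega
    · rcases eq_or_ne x i with rfl | hxi
      · rw [List.count_cons_self]; omega
      · have hx : x ∈ w := (List.mem_cons.1 hx).resolve_left hxi
        have := hother x hxi
        have := List.count_pos_iff.2 hx
        rw [List.count_cons_of_ne hxi.symm]
        omega

lemma sum_defect (f : List ℕ → R) (c : R) (N k : ℕ) :
    ∑ w ∈ words N (k + 2), defect f c k w = ∑ w ∈ words N (k + 2), f w -
      N * (c * ∑ pq ∈ antidiagonal k,
        (∑ u ∈ words N pq.1, f u) * ∑ v ∈ words N pq.2, f v) := by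
  rw [sum_words_succ, sum_words_succ]
  simp only [defect, Finset.sum_sub_distrib]
  congr 1
  have hcomm : ∑ i ∈ Finset.range N, ∑ w ∈ words N (k + 1),
        ∑ pq ∈ antidiagonal k, pairTerm f c i w pq.1 =
      ∑ pq ∈ antidiagonal k, ∑ i ∈ Finset.range N, ∑ w ∈ words N (k + 1),
        pairTerm f c i w pq.1 :=
    (Finset.sum_congr rfl fun i _ => Finset.sum_comm).trans Finset.sum_comm
  rw [hcomm, Finset.mul_sum, Finset.mul_sum]
  refine Finset.sum_congr rfl fun ⟨p, q⟩ hpq => ?_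
  obtain rfl : p + q = k := mem_antidiagonal.1 hpq
  have hterm (i : ℕ) (hi : i ∈ Finset.range N) :
      ∑ w ∈ words N (p + q + 1), pairTerm f c i w p =
        c * ((∑ u ∈ words N p, f u) * ∑ v ∈ words N q, f v) := by
    rw [add_assoc, sum_words_add, Finset.sum_mul_sum, Finset.mul_sum]
    refine Finset.sum_congr rfl fun u hu => ?_
    obtain rfl := (mem_words.1 hu).1
    rw [sum_words_succ, Finset.sum_eq_single_of_mem i hi, Finset.mul_sum]
    · exact Finset.sum_congr rfl fun v _ => pairTerm_append f c i u v
    · intro j _ hj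
      exact Finset.sum_eq_zero fun v _ => if_neg (by simpa using hj)
  rw [Finset.sum_congr rfl hterm]
  simp

end algebra

section limit

variable {R : Type*} [NormedCommRing R] {f : List ℕ → R} {c : R}

lemma exists_norm_le (h : IsPairWeight f c) (k : ℕ) :
    ∃ K : ℝ, 0 ≤ K ∧ ∀ w : List ℕ, w.length = k → ‖f w‖ ≤ K := by
  refine ⟨∑ v ∈ words k k, ‖f v‖, by positivity, ?_⟩
  rintro w rfl
  obtain ⟨σ, hσ, v, hv, hvw⟩ := exists_injective_map_eq w
  have hfw : f w = f v := by rw [← hvw, h.map_injective σ hσ]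
  rw [hfw]
  exact Finset.single_le_sum (f := fun v => ‖f v‖) (fun _ _ => norm_nonneg _) hv

lemma exists_norm_defect_le (h : IsPairWeight f c) (k : ℕ) :
    ∃ K : ℝ, 0 ≤ K ∧ ∀ w : List ℕ, w.length = k + 2 → ‖defect f c k w‖ ≤ K := by
  choose K hK₀ hK using h.exists_norm_le
  refine ⟨K (k + 2) + ∑ pq ∈ antidiagonal k, ‖c‖ * (K pq.1 * K pq.2), ?_, ?_⟩
  · exact add_nonneg (hK₀ _) (Finset.sum_nonneg fun pq _ =>
      mul_nonneg (norm_nonneg _) (mul_nonneg (hK₀ _) (hK₀ _)))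
  · intro w hw
    match w, hw with
    | i :: w, hw =>
      refine (norm_sub_le _ _).trans (add_le_add (hK _ _ hw) ?_)
      refine (norm_sum_le _ _).trans (Finset.sum_le_sum fun ⟨p, q⟩ hpq => ?_)
      rw [mem_antidiagonal] at hpq
      simp only [List.length_cons] at hw hpq
      rw [pairTerm]
      split_ifs
      · refine (norm_mul_le _ _).trans (mul_le_mul_of_nonneg_left ?_ (norm_nonneg _))
        refine (norm_mul_le _ _).trans (mul_le_mul (hK _ _ ?_) (hK _ _ ?_) (norm_nonneg _) (hK₀ _))
        · rw [List.length_take]; omega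
        · rw [List.length_drop]; omega
      · simpa using mul_nonneg (norm_nonneg _) (mul_nonneg (hK₀ _) (hK₀ _))

lemma exists_norm_sum_defect_le (h : IsPairWeight f c) (k : ℕ) :
    ∃ K : ℝ, ∀ N : ℕ, ‖∑ w ∈ words N (k + 2), defect f c k w‖ ≤ K * (N : ℝ) ^ ((k + 1) / 2) := by
  obtain ⟨K, hK₀, hK⟩ := h.exists_norm_defect_le k
  refine ⟨K * (((k + 1) / 2) ^ (k + 2) : ℕ), fun N => ?_⟩
  set d := (k + 1) / 2
  have hsub : ∑ w ∈ words N (k + 2) with w ≠ [] ∧ w.toFinset.card ≤ d, defect f c k w =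
      ∑ w ∈ words N (k + 2), defect f c k w := by
    refine Finset.sum_filter_of_ne fun w hw hd => h.defect_ne_zero (mem_words.1 hw).1 hd
  have hcard : ((((words N (k + 2)).filter fun w => w ≠ [] ∧ w.toFinset.card ≤ d).card : ℕ) : ℝ) ≤
      ((N ^ d * d ^ (k + 2) : ℕ) : ℝ) := Nat.cast_le.2 (card_filter_words_le N (k + 2) d)
  rw [← hsub]
  refine (norm_sum_le_of_le _ fun w hw =>
    hK w (mem_words.1 (Finset.mem_filter.1 hw).1).1).trans ?_
  rw [Finset.sum_const, nsmul_eq_mul]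
  refine (mul_le_mul_of_nonneg_right hcard hK₀).trans_eq ?_
  push_cast
  ring

/-- The limits of the normalized moments. -/
def momentLimit (c : R) (k : ℕ) : R := if Even k then catalan (k / 2) * c ^ (k / 2) else 0

lemma momentLimit_add_two (c : R) (k : ℕ) :
    momentLimit c (k + 2) =
      c * ∑ pq ∈ antidiagonal k, momentLimit c pq.1 * momentLimit c pq.2 := by
  rcases Nat.even_or_odd k with hk | hk
  · obtain ⟨l, rfl⟩ := hk.exists_two_nsmul
    have hinj : Function.Injective fun p : ℕ × ℕ => (2 * p.1, 2 * p.2) := by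
      rintro ⟨p, q⟩ ⟨p', q'⟩ h
      simpa using h
    have hsum : ∑ pq ∈ antidiagonal (2 * l), momentLimit c pq.1 * momentLimit c pq.2 =
        ∑ pq ∈ antidiagonal l, momentLimit c (2 * pq.1) * momentLimit c (2 * pq.2) := by
      symm
      rw [← Finset.sum_image (f := fun pq : ℕ × ℕ => momentLimit c pq.1 * momentLimit c pq.2)
        (g := fun p : ℕ × ℕ => (2 * p.1, 2 * p.2)) hinj.injOn]
      refine Finset.sum_subset ?_ ?_
      · intro x hx
        simp only [Finset.mem_image, mem_antidiagonal] at hx ⊢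
        obtain ⟨p, hp, rfl⟩ := hx
        simp only
        omega
      · rintro ⟨p, q⟩ hpq hnot
        rw [mem_antidiagonal] at hpq
        have hp : ¬ Even p := by
          rintro ⟨r, rfl⟩
          refine hnot (Finset.mem_image.2 ⟨(r, l - r), ?_, ?_⟩)
          · rw [mem_antidiagonal]
            simp only at hpq ⊢
            omega
          · simp only [Prod.mk.injEq] at hpq ⊢
            omega
        simp [momentLimit, hp]
    rw [smul_eq_mul, hsum]
    have hdiv : (2 * l + 2) / 2 = l + 1 := by omega
    have heven : Even (2 * l + 2) := by simp [parity_simps]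
    rw [momentLimit, if_pos heven, hdiv, catalan_succ', pow_succ', Nat.cast_sum, Finset.sum_mul,
      Finset.mul_sum]
    refine Finset.sum_congr rfl fun ⟨p, q⟩ hpq => ?_
    obtain rfl : p + q = l := mem_antidiagonal.1 hpq
    simp [momentLimit, pow_add]
    ring
  · have hk' : ¬ Even (k + 2) := by simpa [parity_simps] using hk
    rw [momentLimit, if_neg hk', Finset.sum_eq_zero, mul_zero]
    rintro ⟨p, q⟩ hpq
    obtain rfl : p + q = k := mem_antidiagonal.1 hpq
    rcases Nat.even_or_odd p with hp | hp
    · have hq : ¬ Even q := by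
        rw [Nat.not_even_iff_odd]
        exact (Nat.odd_add'.1 hk).2 hp
      simp [momentLimit, hq]
    · simp [momentLimit, Nat.not_even_iff_odd.2 hp]

variable [NormedAlgebra ℂ R]

lemma normalized_recursion (f : List ℕ → R) (c : R) {N : ℕ} (hN : N ≠ 0) (k : ℕ) :
    ((Real.sqrt N : ℂ)⁻¹) ^ (k + 2) • ∑ w ∈ words N (k + 2), f w =
      c * ∑ pq ∈ antidiagonal k,
        (((Real.sqrt N : ℂ)⁻¹) ^ pq.1 • ∑ u ∈ words N pq.1, f u) *
          (((Real.sqrt N : ℂ)⁻¹) ^ pq.2 • ∑ v ∈ words N pq.2, f v) +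
      ((Real.sqrt N : ℂ)⁻¹) ^ (k + 2) • ∑ w ∈ words N (k + 2), defect f c k w := by
  set r : ℂ := (Real.sqrt N : ℂ)⁻¹ with hr
  have hrN : r ^ 2 * N = 1 := by
    have : (Real.sqrt N : ℂ) ^ 2 = N := by
      rw [← Complex.ofReal_pow, Real.sq_sqrt (Nat.cast_nonneg N), Complex.ofReal_natCast]
    rw [hr, inv_pow, this, inv_mul_cancel₀ (Nat.cast_ne_zero.2 hN)]
  have hsum : ∑ pq ∈ antidiagonal k, (r ^ pq.1 • ∑ u ∈ words N pq.1, f u) *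
      (r ^ pq.2 • ∑ v ∈ words N pq.2, f v) = r ^ k • ∑ pq ∈ antidiagonal k,
        (∑ u ∈ words N pq.1, f u) * ∑ v ∈ words N pq.2, f v := by
    rw [Finset.smul_sum]
    refine Finset.sum_congr rfl fun ⟨p, q⟩ hpq => ?_
    obtain rfl : p + q = k := mem_antidiagonal.1 hpq
    rw [smul_mul_smul_comm, pow_add]
  have hcast (x : R) : r ^ (k + 2) • ((N : R) * x) = r ^ k • x := by
    rw [← nsmul_eq_mul, ← Nat.cast_smul_eq_nsmul ℂ, smul_smul, pow_add, mul_assoc, hrN, mul_one]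
  rw [sum_defect, smul_sub, hcast, hsum, mul_smul_comm]
  abel

lemma tendsto_normalized_defect (h : IsPairWeight f c) (k : ℕ) :
    Tendsto (fun N : ℕ =>
      ((Real.sqrt N : ℂ)⁻¹) ^ (k + 2) • ∑ w ∈ words N (k + 2), defect f c k w) atTop (𝓝 0) := by
  obtain ⟨K, hK⟩ := h.exists_norm_sum_defect_le k
  have hlim : Tendsto (fun N : ℕ => K * (Real.sqrt N)⁻¹) atTop (𝓝 0) := by
    simpa using ((Real.tendsto_sqrt_atTop.comp tendsto_natCast_atTop_atTop).inv_tendsto_atTop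
      ).const_mul K
  refine squeeze_zero_norm' ?_ hlim
  filter_upwards [eventually_ge_atTop 1] with N hN
  have hK₀ : 0 ≤ K := by simpa using (norm_nonneg _).trans (hK 1)
  have hs : 1 ≤ Real.sqrt N := Real.one_le_sqrt.2 (by exact_mod_cast hN)
  have hpow : (N : ℝ) ^ ((k + 1) / 2) ≤ Real.sqrt N ^ (k + 1) := by
    calc (N : ℝ) ^ ((k + 1) / 2) = Real.sqrt N ^ (2 * ((k + 1) / 2)) := by
          rw [pow_mul, Real.sq_sqrt (Nat.cast_nonneg N)]
      _ ≤ _ := pow_le_pow_right₀ hs (by omega)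
  have hnorm : ‖((Real.sqrt N : ℂ)⁻¹) ^ (k + 2)‖ = (Real.sqrt N)⁻¹ ^ (k + 2) := by
    rw [norm_pow, norm_inv, Complex.norm_real, Real.norm_of_nonneg (Real.sqrt_nonneg _)]
  rw [norm_smul, hnorm]
  have hs₀ : Real.sqrt N ≠ 0 := by positivity
  calc (Real.sqrt N)⁻¹ ^ (k + 2) * ‖∑ w ∈ words N (k + 2), defect f c k w‖
      ≤ (Real.sqrt N)⁻¹ ^ (k + 2) * (K * Real.sqrt N ^ (k + 1)) := by
        gcongr
        exact (hK N).trans (by gcongr)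
    _ = K * (Real.sqrt N)⁻¹ := by
        rw [inv_pow, pow_succ (Real.sqrt N) (k + 1)]
        field_simp

theorem tendsto_normalized_sum (h : IsPairWeight f c) (k : ℕ) :
    Tendsto (fun N : ℕ => ((Real.sqrt N : ℂ)⁻¹) ^ k • ∑ w ∈ words N k, f w) atTop
      (𝓝 (momentLimit c k)) := by
  induction k using Nat.strong_induction_on with
  | _ k ih =>
    match k, ih with
    | 0, _ => simp [words, h.nil, momentLimit]
    | 1, _ =>
      have h₁ (i : ℕ) : f [i] = 0 := h.singleton [] [] i (by simp) (by simp)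
      simp [words, h₁, momentLimit]
    | k + 2, ih =>
      have hmain : Tendsto (fun N : ℕ => c * ∑ pq ∈ antidiagonal k,
          (((Real.sqrt N : ℂ)⁻¹) ^ pq.1 • ∑ u ∈ words N pq.1, f u) *
            (((Real.sqrt N : ℂ)⁻¹) ^ pq.2 • ∑ v ∈ words N pq.2, f v)) atTop
          (𝓝 (momentLimit c (k + 2))) := by
        rw [momentLimit_add_two]
        refine (tendsto_finsetSum _ fun pq hpq => ?_).const_mul c
        rw [mem_antidiagonal] at hpq
        exact (ih pq.1 (by omega)).mul (ih pq.2 (by omega))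
      rw [← add_zero (momentLimit c (k + 2))]
      refine (hmain.add (h.tendsto_normalized_defect k)).congr' ?_
      filter_upwards [eventually_ge_atTop 1] with N hN
      exact (normalized_recursion f c (by omega) k).symm

end limit

end IsPairWeight

/-- The joint values of `(φ, φ')` on words in `b`, as dual numbers, form a weight of pairs. -/
lemma IsInfFreeFamily.isPairWeight {φ φ' : A →ₗ[ℂ] ℂ} {μ μ' : ℂ[X] →ₗ[ℂ] ℂ} {b : ℕ → A}
    (h : IsInfFreeFamily φ φ' μ μ' b) (hX : μ X = 0) (hX' : μ' X = 0) :
    IsPairWeight (fun w => (TrivSqZeroExt.inl (φ (w.map b).prod) + TrivSqZeroExt.inr (φ' (w.map b).prod) :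
        TrivSqZeroExt ℂ ℂ))
      (TrivSqZeroExt.inl (μ (X ^ 2)) + TrivSqZeroExt.inr (μ' (X ^ 2))) := by
  have hmem {i : ℕ} {w : List ℕ} (hi : i ∉ w) :
      (w.map b).prod ∈ Algebra.adjoin ℂ (b '' {i}ᶜ) := by
    refine Subalgebra.list_prod_mem _ fun x hx => ?_
    obtain ⟨j, hj, rfl⟩ := List.mem_map.1 hx
    exact Algebra.subset_adjoin ⟨j, fun hji => hi (hji ▸ hj), rfl⟩
  refine ⟨?_, fun σ hσ w => ?_, fun u v i hu hv => ?_, fun u v i hu hv => ?_⟩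
  · exact TrivSqZeroExt.ext (by simpa using h.map_one) (by simpa using h.map_one')
  · obtain ⟨h₁, h₂⟩ := h.map_word_comp_injective hσ w
    rw [h₁, h₂]
  · have h₁ := h.map_mul_centered_mul (i := i) (J := {i}ᶜ) (by simp) hX (hmem hu) (hmem hv)
    have h₂ := h.map_mul_mul' hX hX' (i := i) (J := {i}ᶜ) (by simp) (hmem hu) (hmem hv)
    exact TrivSqZeroExt.ext (by simpa [mul_assoc] using h₁) (by simpa [mul_assoc] using h₂)
  · have h₁ := h.map_pair hX (i := i) (J := {i}ᶜ) (by simp) (hmem hu) (hmem hv)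
    have h₂ := h.map_pair' hX hX' (i := i) (J := {i}ᶜ) (by simp) (hmem hu) (hmem hv)
    simp only [mul_assoc] at h₁ h₂
    refine TrivSqZeroExt.ext (by simpa using h₁) ?_
    simp [h₂]
    ring

/-- Theorem (infinitesimal free CLT, moment form): for an infinitesimally free,
identically distributed sequence `(aᵢ)` with `φ(a₁) = φ'(a₁) = 0`, `φ(a₁²) = 1`,
`φ'(a₁²) = α`, the moments of `S_N = (a₁+⋯+a_N)/√N` converge to the Catalan numbers
(the moments of the standard semicircle law) and the infinitesimal moments converge to
`α·(k/2)·Catalan(k/2)` for even `k` (and `0` for odd `k`). -/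
theorem infinitesimal_free_clt
    (φ φ' : A →ₗ[ℂ] ℂ) (hφ1 : φ 1 = 1) (hφ'1 : φ' 1 = 0)
    (a : ℕ → A) (α : ℂ)
    (hindep : InfFreeSeq ⇑φ ⇑φ' fun i => Algebra.adjoin ℂ {a i})
    (hident : ∀ k : ℕ, 1 ≤ k → ∀ i j : ℕ, φ (a i ^ k) = φ (a j ^ k) ∧ φ' (a i ^ k) = φ' (a j ^ k))
    (h1 : φ (a 0) = 0) (h1' : φ' (a 0) = 0)
    (h2 : φ (a 0 ^ 2) = 1) (h2' : φ' (a 0 ^ 2) = α)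
    (k : ℕ) (hk : 1 ≤ k) :
    Tendsto
      (fun N : ℕ => φ ((((Real.sqrt N : ℂ))⁻¹ • ∑ i ∈ Finset.range N, a i) ^ k))
      atTop (𝓝 (if Even k then (catalan (k / 2) : ℂ) else 0)) ∧
    Tendsto
      (fun N : ℕ => φ' ((((Real.sqrt N : ℂ))⁻¹ • ∑ i ∈ Finset.range N, a i) ^ k))
      atTop (𝓝 (if Even k then α * ((k / 2 : ℕ) : ℂ) * (catalan (k / 2) : ℂ) else 0)) := by
  have h := (hindep.isInfFreeFamily hφ1 hφ'1 hident).isPairWeight (by simpa using h1)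
    (by simpa using h1')
  have hlim := h.tendsto_normalized_sum k
  have hpow (N : ℕ) : (((Real.sqrt N : ℂ))⁻¹ • ∑ i ∈ Finset.range N, a i) ^ k =
      ((Real.sqrt N : ℂ)⁻¹) ^ k • ∑ w ∈ words N k, (w.map a).prod := by
    rw [_root_.smul_pow, sum_pow_eq_sum_words]
  refine ⟨?_, ?_⟩
  · have hfst := (TrivSqZeroExt.continuous_fst.tendsto _).comp hlim
    convert hfst using 2
    · simp [hpow, TrivSqZeroExt.fst_sum]
    · split_ifs with hk' <;> simp [IsPairWeight.momentLimit, hk', h2]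
  · have hsnd := (TrivSqZeroExt.continuous_snd.tendsto _).comp hlim
    convert hsnd using 2
    · simp [hpow, TrivSqZeroExt.snd_sum]
    · split_ifs with hk'
      · simp [IsPairWeight.momentLimit, hk', h2, h2']
        ring
      · simp [IsPairWeight.momentLimit, hk']
end
end
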